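/- arXiv:2201.06067 — 2 statements merged into one kernel-verified Lean document; each statement's English description precedes it below -/
import Mathlib

section
/- Let 𝒻 be an intersecting family of circles in the elliptic-quadric Möbius plane of odd order q with q > 3; that is, 𝒻 is a set of non-isotropic points of ℙ(F⁴) such that for all P, R ∈ 𝒻 there is an isotropic point S whose representatives s satisfy b(s,p) = 0 and b(s,r) = 0 for representatives p of P and r of R. Then |𝒻| ≤ q(q+1), and |𝒻| = q(q+1) if and only if there exists an isotropic point S such that 𝒻 is exactly the set of all non-isotropic points P whose representatives p satisfy b(s,p) = 0 for representatives s of S. -/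
section

open Finset

variable {W : Type*} [Fintype W] [DecidableEq W] (G : SimpleGraph W) [DecidableRel G.Adj]

theorem card_incidenceFinset_inter_le_one {u v : W} (h : u ≠ v) :
    #(G.incidenceFinset u ∩ G.incidenceFinset v) ≤ 1 := by
  have hsub : G.incidenceFinset u ∩ G.incidenceFinset v ⊆ {s(u, v)} := by
    intro x hx
    simp only [mem_inter, SimpleGraph.mem_incidenceFinset] at hx
    exact mem_singleton.2 (G.incidenceSet_inter_incidenceSet_subset h hx)
  simpa using card_le_card hsub

theorem incidenceFinset_union_subset (u v : W) :
    G.incidenceFinset u ∪ G.incidenceFinset v ⊆ G.edgeFinset :=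
  union_subset (G.incidenceFinset_subset u) (G.incidenceFinset_subset v)

theorem degree_add_degree_le {u v : W} (h : G.Adj u v) :
    G.degree u + G.degree v ≤ #G.edgeFinset + 1 := by
  rw [← G.card_incidenceFinset_eq_degree, ← G.card_incidenceFinset_eq_degree,
    ← card_union_add_card_inter]
  exact add_le_add (card_le_card (incidenceFinset_union_subset G u v))
    (card_incidenceFinset_inter_le_one G h.ne)

theorem mem_or_mem_of_degree_add_degree_eq {u v : W} (h : G.Adj u v)
    (hd : G.degree u + G.degree v = #G.edgeFinset + 1) {e : Sym2 W} (he : e ∈ G.edgeFinset) :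
    u ∈ e ∨ v ∈ e := by
  rw [← G.card_incidenceFinset_eq_degree, ← G.card_incidenceFinset_eq_degree,
    ← card_union_add_card_inter] at hd
  have h1 := card_incidenceFinset_inter_le_one G h.ne
  rw [← eq_of_subset_of_card_le (incidenceFinset_union_subset G u v) (by omega), mem_union,
    SimpleGraph.mem_incidenceFinset, SimpleGraph.mem_incidenceFinset] at he
  exact he.imp (fun h => h.2) (fun h => h.2)

omit [DecidableEq W] in
theorem sum_sum_degree_add_degree :
    ∑ u, ∑ v ∈ G.neighborFinset u, (G.degree u + G.degree v) = 2 * ∑ u, G.degree u ^ 2 := by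
  have h1 : ∑ u, ∑ v ∈ G.neighborFinset u, G.degree v =
      ∑ v, ∑ u ∈ G.neighborFinset v, G.degree v :=
    sum_comm' (by simp [G.adj_comm])
  simp only [sum_add_distrib, h1]
  simp [_root_.sq, two_mul]

omit [DecidableEq W] in
theorem sum_sum_neighborFinset_const (c : ℕ) :
    ∑ u, ∑ _v ∈ G.neighborFinset u, c = 2 * (#G.edgeFinset * c) := by
  simp only [sum_const, G.card_neighborFinset_eq_degree, smul_eq_mul]
  rw [← sum_mul, G.sum_degrees_eq_twice_card_edges, mul_assoc]

theorem sum_degree_sq_le : ∑ u, G.degree u ^ 2 ≤ #G.edgeFinset * (#G.edgeFinset + 1) := by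
  have h1 := sum_sum_degree_add_degree G
  have h2 := sum_sum_neighborFinset_const G (#G.edgeFinset + 1)
  have h3 : ∑ u, ∑ v ∈ G.neighborFinset u, (G.degree u + G.degree v) ≤
      ∑ u, ∑ _v ∈ G.neighborFinset u, (#G.edgeFinset + 1) :=
    sum_le_sum fun u _ => sum_le_sum fun v hv =>
      degree_add_degree_le G ((G.mem_neighborFinset u v).1 hv)
  omega

/-- A graph with at least four edges attaining the bound `sum_degree_sq_le` is a star. -/
theorem exists_degree_eq_card_edgeFinset (h4 : 4 ≤ #G.edgeFinset)
    (h : #G.edgeFinset * (#G.edgeFinset + 1) ≤ ∑ u, G.degree u ^ 2) :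
    ∃ u, G.degree u = #G.edgeFinset := by
  have h1 := sum_sum_degree_add_degree G
  have h2 := sum_sum_neighborFinset_const G (#G.edgeFinset + 1)
  have hle : ∀ u ∈ univ, ∀ v ∈ G.neighborFinset u,
      G.degree u + G.degree v ≤ #G.edgeFinset + 1 := fun u _ v hv =>
    degree_add_degree_le G ((G.mem_neighborFinset u v).1 hv)
  have heq : ∀ u v, G.Adj u v → G.degree u + G.degree v = #G.edgeFinset + 1 := by
    have h3 : ∑ u, ∑ v ∈ G.neighborFinset u, (G.degree u + G.degree v) =
        ∑ u, ∑ _v ∈ G.neighborFinset u, (#G.edgeFinset + 1) :=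
      le_antisymm (sum_le_sum fun u hu => sum_le_sum (hle u hu)) (by omega)
    intro u v huv
    have h4 := (sum_eq_sum_iff_of_le fun u hu => sum_le_sum (hle u hu)).1 h3 u (mem_univ u)
    exact (sum_eq_sum_iff_of_le (hle u (mem_univ u))).1 h4 v ((G.mem_neighborFinset u v).2 huv)
  obtain ⟨u, hu⟩ : ∃ u, 3 ≤ G.degree u := by
    by_contra! hlt
    have h5 : ∑ u, G.degree u ^ 2 ≤ ∑ u, 2 * G.degree u :=
      sum_le_sum fun u _ => by have := hlt u; nlinarith
    rw [← mul_sum, G.sum_degrees_eq_twice_card_edges] at h5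
    nlinarith
  refine ⟨u, ?_⟩
  rw [← G.card_incidenceFinset_eq_degree]
  congr 1
  refine (G.incidenceFinset_subset u).antisymm fun e he => ?_
  rw [SimpleGraph.mem_incidenceFinset]
  refine ⟨by simpa using he, ?_⟩
  by_contra hue
  induction e with
  | h a b =>
    have hsub : G.neighborFinset u ⊆ {a, b} := by
      intro v hv
      have huv := (G.mem_neighborFinset u v).1 hv
      have := (mem_or_mem_of_degree_add_degree_eq G huv (heq u v huv) he).resolve_left hue
      simpa using this
    have := (card_le_card hsub).trans card_le_two
    rw [G.card_neighborFinset_eq_degree] at this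
    omega

end

section

open QuadraticMap Finset
open scoped Classical

variable {F V : Type*} [Field F] [Fintype F] [AddCommGroup V] [Module F V] [Fintype V]

theorem card_mul_card_filter_ker (U : Submodule F V) (φ : V →ₗ[F] F) (h : ∃ x ∈ U, φ x ≠ 0) :
    Fintype.card F * #{x : V | x ∈ U ∧ φ x = 0} = #{x : V | x ∈ U} := by
  obtain ⟨x, hx, hφ⟩ := h
  have key : #{x : V | x ∈ U} = ∑ t : F, #{y ∈ ({x : V | x ∈ U} : Finset V) | φ y = t} :=
    card_eq_sum_card_fiberwise (fun _ _ => mem_univ _)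
  rw [key, ← card_univ, ← smul_eq_mul, ← sum_const]
  refine sum_congr rfl fun t _ => ?_
  rw [filter_filter]
  refine card_bij' (fun y _ => y + (t / φ x) • x) (fun y _ => y - (t / φ x) • x) ?_ ?_ ?_ ?_
  · intro y hy
    simp only [mem_filter, mem_univ, true_and] at hy ⊢
    refine ⟨U.add_mem hy.1 (U.smul_mem _ hx), ?_⟩
    simp [hy.2, hφ]
  · intro y hy
    simp only [mem_filter, mem_univ, true_and] at hy ⊢
    refine ⟨U.sub_mem hy.1 (U.smul_mem _ hx), ?_⟩
    simp [hy.2, hφ]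
  · simp
  · simp

variable (κ : QuadraticForm F V)

theorem card_filter_polar_ne_zero (U : Submodule F V) {s : V} (hs : s ∈ U) (hκ : κ s = 0) :
    #{x : V | x ∈ U ∧ polar κ s x ≠ 0} =
      Fintype.card F * #{x : V | (x ∈ U ∧ polar κ s x ≠ 0) ∧ κ x = 0} := by
  have hss : polar κ s s = 0 := by rw [polar_self, hκ, smul_zero]
  rw [← card_univ, ← card_product]
  refine card_bij' (fun y _ => (κ y / polar κ s y, y - (κ y / polar κ s y) • s))
    (fun z _ => z.2 + z.1 • s) ?_ ?_ ?_ ?_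
  · intro y hy
    simp only [mem_filter, mem_univ, true_and, mem_product] at hy ⊢
    have h1 : polar κ s (y - (κ y / polar κ s y) • s) = polar κ s y := by
      rw [polar_sub_right, polar_smul_right, hss]; simp
    refine ⟨⟨U.sub_mem hy.1 (U.smul_mem _ hs), by rw [h1]; exact hy.2⟩, ?_⟩
    rw [sub_eq_add_neg, ← neg_smul, QuadraticMap.map_add κ, QuadraticMap.map_smul, hκ,
      polar_smul_right, polar_comm _ y s]
    have := hy.2
    simp only [smul_eq_mul]
    field_simp
    ring
  · intro z hz
    simp only [mem_filter, mem_univ, true_and, mem_product] at hz ⊢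
    refine ⟨U.add_mem hz.1.1 (U.smul_mem _ hs), ?_⟩
    rw [polar_add_right, polar_smul_right, hss]; simpa using hz.1.2
  · simp
  · rintro ⟨t, y⟩ hz
    simp only [mem_filter, mem_univ, true_and, mem_product] at hz ⊢
    have h1 : polar κ s (y + t • s) = polar κ s y := by
      rw [polar_add_right, polar_smul_right, hss]; simp
    have h2 : κ (y + t • s) = t * polar κ s y := by
      rw [QuadraticMap.map_add κ, QuadraticMap.map_smul, hκ, hz.2, polar_smul_right,
        polar_comm _ y s]
      simp
    rw [h1, h2, mul_div_cancel_right₀ _ hz.1.2]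
    simp

theorem card_filter_polar_eq_zero (U : Submodule F V) {s : V} (h : ∃ x ∈ U, polar κ s x ≠ 0) :
    Fintype.card F * #{x : V | x ∈ U ∧ polar κ s x = 0} = #{x : V | x ∈ U} :=
  card_mul_card_filter_ker U (κ.polarBilin s) h

theorem card_filter_add_card_filter {α : Type*} [Fintype α] {A P Q : α → Prop} (B : α → Prop)
    [DecidablePred A] [DecidablePred P] [DecidablePred Q]
    (hP : ∀ x, P x ↔ A x ∧ B x) (hQ : ∀ x, Q x ↔ A x ∧ ¬ B x) :
    #{x | P x} + #{x | Q x} = #{x | A x} := by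
  have hP' : ({x | P x} : Finset α) = {x ∈ ({x | A x} : Finset α) | B x} := by
    ext x; simp [hP]
  have hQ' : ({x | Q x} : Finset α) = {x ∈ ({x | A x} : Finset α) | ¬ B x} := by
    ext x; simp [hQ]
  rw [hP', hQ']
  exact card_filter_add_card_filter_not B

omit [Fintype F] in
theorem card_isotropic_ne_zero :
    #{x : V | κ x = 0 ∧ x ≠ 0} + 1 = #{x : V | κ x = 0} := by
  have h : #{x : V | κ x = 0 ∧ x = 0} = 1 := by
    rw [card_eq_one]; refine ⟨0, ?_⟩
    ext x; simp only [mem_filter, mem_univ, true_and, mem_singleton]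
    constructor
    · exact fun h => h.2
    · rintro rfl; simp
  rw [← h, add_comm]
  exact card_filter_add_card_filter (fun x => x = 0) (by simp) (by simp)

/-- The isotropic vectors of an elliptic quadric in a four-dimensional space of odd
characteristic. -/
structure IsElliptic (q : ℕ) : Prop where
  one_lt : 1 < q
  two_ne_zero : (2 : F) ≠ 0
  card_field : Fintype.card F = q
  card_space : Fintype.card V = q ^ 4
  nondegenerate : ∀ x : V, (∀ y, polar κ x y = 0) → x = 0
  card_isotropic : #{x : V | κ x = 0} + q ^ 2 = q ^ 3 + q

variable {κ} {q : ℕ}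

theorem IsElliptic.exists_polar_ne_zero (hE : IsElliptic κ q) {x : V} (hx : x ≠ 0) :
    ∃ y, polar κ x y ≠ 0 := by
  by_contra! h
  exact hx (hE.nondegenerate x h)

theorem IsElliptic.card_perp (hE : IsElliptic κ q) {x : V} (hx : x ≠ 0) :
    #{y : V | polar κ x y = 0} = q ^ 3 := by
  obtain ⟨y, hy⟩ := hE.exists_polar_ne_zero hx
  have := card_filter_polar_eq_zero κ ⊤ ⟨y, Submodule.mem_top, hy⟩
  simp only [Submodule.mem_top, true_and, filter_true, card_univ, hE.card_field,
    hE.card_space] at this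
  have hq := hE.one_lt
  refine Nat.eq_of_mul_eq_mul_left (by omega : 0 < q) ?_
  rw [this]; ring

theorem IsElliptic.card_isotropic_perp_isotropic (hE : IsElliptic κ q) {s : V} (hs : s ≠ 0)
    (hκ : κ s = 0) : #{x : V | κ x = 0 ∧ polar κ s x = 0} = q := by
  have h1 := hE.card_perp hs
  have h2 := card_filter_polar_ne_zero κ ⊤ (s := s) Submodule.mem_top hκ
  have h3 : #{x : V | polar κ s x = 0} + #{x : V | polar κ s x ≠ 0} = #{x : V | True} :=
    card_filter_add_card_filter (fun x => polar κ s x = 0) (by simp) (by simp)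
  have h4 : #{x : V | κ x = 0 ∧ polar κ s x = 0} + #{x : V | polar κ s x ≠ 0 ∧ κ x = 0} =
      #{x : V | κ x = 0} :=
    card_filter_add_card_filter (fun x => polar κ s x = 0) (by simp) (by simp [and_comm])
  have h5 := hE.card_isotropic
  simp only [Submodule.mem_top, true_and, filter_true, card_univ, hE.card_field,
    hE.card_space] at h2 h3
  have hq := hE.one_lt
  generalize #{x : V | polar κ s x ≠ 0 ∧ κ x = 0} = a at *
  have h6 : q * (a + q ^ 2) = q * q ^ 3 := by linarith [h1, h2, h3, pow_succ q 3]
  have h7 := Nat.eq_of_mul_eq_mul_left (by omega : 0 < q) h6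
  omega

theorem IsElliptic.exists_eq_smul (hE : IsElliptic κ q) {s x : V} (hs : s ≠ 0)
    (hκ : κ s = 0) (hx : κ x = 0) (hsx : polar κ s x = 0) : ∃ a : F, x = a • s := by
  have hinj : Function.Injective (fun a : F => a • s) := smul_left_injective F hs
  have hss : polar κ s s = 0 := by rw [polar_self, hκ, smul_zero]
  have hsub : (univ.image fun a : F => a • s) ⊆ ({x : V | κ x = 0 ∧ polar κ s x = 0} : Finset V) := by
    intro y hy
    obtain ⟨a, -, rfl⟩ := mem_image.1 hy
    simp [QuadraticMap.map_smul, hκ, polar_smul_right, hss]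
  have heq := eq_of_subset_of_card_le hsub (by
    rw [hE.card_isotropic_perp_isotropic hs hκ, card_image_of_injective _ hinj, card_univ,
      hE.card_field])
  have : x ∈ ({x : V | κ x = 0 ∧ polar κ s x = 0} : Finset V) := by simp [hx, hsx]
  rw [← heq] at this
  obtain ⟨a, -, ha⟩ := mem_image.1 this
  exact ⟨a, ha.symm⟩

theorem IsElliptic.card_isotropic_perp_le (hE : IsElliptic κ q) {v : V} (hv : κ v ≠ 0) :
    #{x : V | (κ x = 0 ∧ x ≠ 0) ∧ polar κ v x = 0} ≤ q ^ 2 - 1 := by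
  by_cases h : ∃ s, (κ s = 0 ∧ s ≠ 0) ∧ polar κ v s = 0
  swap
  · push Not at h
    rw [filter_false_of_mem]
    · simp
    · intro x _ hx
      exact h x hx.1 hx.2
  obtain ⟨s, ⟨hκ, hs⟩, hvs⟩ := h
  have hv0 : v ≠ 0 := by rintro rfl; simp at hv
  let U : Submodule F V := LinearMap.ker (κ.polarBilin v)
  have hU : ∀ x, x ∈ U ↔ polar κ v x = 0 := fun x => LinearMap.mem_ker
  have hvv : polar κ v v ≠ 0 := by
    rw [polar_self, nsmul_eq_mul]; exact mul_ne_zero (by exact_mod_cast hE.two_ne_zero) hv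
  have hex : ∃ x ∈ U, polar κ s x ≠ 0 := by
    obtain ⟨y, hy⟩ := hE.exists_polar_ne_zero hs
    refine ⟨y - (polar κ v y / polar κ v v) • v, ?_, ?_⟩
    · rw [hU, polar_sub_right, polar_smul_right, smul_eq_mul, div_mul_cancel₀ _ hvv, sub_self]
    · rw [polar_sub_right, polar_smul_right, polar_comm _ s v, hvs, smul_zero, sub_zero]
      exact hy
  have h1 := card_filter_polar_eq_zero κ U hex
  have h2 := card_filter_polar_ne_zero κ U ((hU s).2 hvs) hκ
  have h3 : #{x : V | x ∈ U ∧ polar κ s x = 0} + #{x : V | x ∈ U ∧ polar κ s x ≠ 0} =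
      #{x : V | x ∈ U} :=
    card_filter_add_card_filter (fun x => polar κ s x = 0) (by simp) (by simp)
  have h4 : #{x : V | (x ∈ U ∧ κ x = 0) ∧ polar κ s x = 0} +
      #{x : V | (x ∈ U ∧ polar κ s x ≠ 0) ∧ κ x = 0} = #{x : V | x ∈ U ∧ κ x = 0} :=
    card_filter_add_card_filter (fun x => polar κ s x = 0) (by simp)
      (by simp [and_right_comm])
  have h5 : #{x : V | (x ∈ U ∧ κ x = 0) ∧ x = 0} +
      #{x : V | (κ x = 0 ∧ x ≠ 0) ∧ polar κ v x = 0} = #{x : V | x ∈ U ∧ κ x = 0} :=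
    card_filter_add_card_filter (fun x => x = 0) (by simp) (fun x => by rw [hU]; tauto)
  have h6 := hE.card_isotropic_perp_isotropic hs hκ
  have h7 : #{x : V | (x ∈ U ∧ κ x = 0) ∧ polar κ s x = 0} ≤ q :=
    h6 ▸ card_le_card fun x hx => by
      simp only [mem_filter, mem_univ, true_and] at hx ⊢; exact ⟨hx.1.2, hx.2⟩
  have h8 : #{x : V | (x ∈ U ∧ κ x = 0) ∧ x = 0} = 1 := by
    rw [card_eq_one]; refine ⟨0, ?_⟩
    ext x; simp only [mem_filter, mem_univ, true_and, mem_singleton]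
    constructor
    · exact fun h => h.2
    · rintro rfl; simp
  have h9 := hE.card_perp hv0
  simp only [← hU] at h9
  rw [h9] at h1 h3
  rw [hE.card_field] at h1 h2
  have hq := hE.one_lt
  have h11 : #{x : V | x ∈ U ∧ polar κ s x = 0} = q ^ 2 :=
    Nat.eq_of_mul_eq_mul_left (by omega : 0 < q) (by rw [h1]; ring)
  rw [h11, h2] at h3
  have h12 : q + #{x : V | (x ∈ U ∧ polar κ s x ≠ 0) ∧ κ x = 0} = q ^ 2 :=
    Nat.eq_of_mul_eq_mul_left (by omega : 0 < q) (by rw [mul_add]; linarith [h3, pow_succ q 2])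
  omega

theorem IsElliptic.card_nonisotropic_perp_isotropic (hE : IsElliptic κ q) {s : V} (hs : s ≠ 0)
    (hκ : κ s = 0) : #{x : V | κ x ≠ 0 ∧ polar κ s x = 0} = q ^ 3 - q := by
  have h1 := hE.card_perp hs
  have h2 := hE.card_isotropic_perp_isotropic hs hκ
  have h3 : #{x : V | κ x = 0 ∧ polar κ s x = 0} + #{x : V | κ x ≠ 0 ∧ polar κ s x = 0} =
      #{x : V | polar κ s x = 0} :=
    card_filter_add_card_filter (fun x => κ x = 0) (by simp [and_comm]) (by simp [and_comm])
  omega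

theorem IsElliptic.card_isotropic_perp (hE : IsElliptic κ q) {v : V} (hv : κ v ≠ 0) :
    #{x : V | (κ x = 0 ∧ x ≠ 0) ∧ polar κ v x = 0} = q ^ 2 - 1 := by
  have hq := hE.one_lt
  have hdc := sum_card_bipartiteAbove_eq_sum_card_bipartiteBelow
    (s := ({v : V | κ v ≠ 0} : Finset V)) (t := ({x : V | κ x = 0 ∧ x ≠ 0} : Finset V))
    (fun v x => polar κ v x = 0)
  simp only [bipartiteAbove, bipartiteBelow, filter_filter] at hdc
  have hr : ∀ s ∈ ({x : V | κ x = 0 ∧ x ≠ 0} : Finset V),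
      #{a : V | κ a ≠ 0 ∧ polar κ a s = 0} = q ^ 3 - q := by
    intro s hs
    simp only [mem_filter, mem_univ, true_and] at hs
    simp only [polar_comm _ _ s]
    exact hE.card_nonisotropic_perp_isotropic hs.2 hs.1
  rw [sum_congr rfl hr, sum_const, smul_eq_mul] at hdc
  have h1 := card_isotropic_ne_zero κ
  have h2 : #{x : V | κ x = 0} + #{x : V | κ x ≠ 0} = #{x : V | True} :=
    card_filter_add_card_filter (fun x => κ x = 0) (by simp) (by simp)
  have h3 := hE.card_isotropic
  simp only [filter_true, card_univ, hE.card_space] at h2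
  have hle : ∀ v ∈ ({v : V | κ v ≠ 0} : Finset V),
      #{x : V | (κ x = 0 ∧ x ≠ 0) ∧ polar κ v x = 0} ≤ q ^ 2 - 1 := fun v hv =>
    hE.card_isotropic_perp_le (mem_filter.1 hv).2
  have hsum : ∑ v ∈ ({v : V | κ v ≠ 0} : Finset V),
      #{x : V | (κ x = 0 ∧ x ≠ 0) ∧ polar κ v x = 0} =
      ∑ v ∈ ({v : V | κ v ≠ 0} : Finset V), (q ^ 2 - 1) := by
    rw [hdc, sum_const, smul_eq_mul]
    have hq3 : q ≤ q ^ 3 := Nat.le_self_pow (by norm_num) q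
    have hq2 : 1 ≤ q ^ 2 := Nat.one_le_pow _ _ (by omega)
    zify [hq2, hq3] at *
    have e1 : (#{x : V | κ x = 0 ∧ x ≠ 0} : ℤ) = q ^ 3 + q - q ^ 2 - 1 := by linarith
    have e2 : (#{x : V | κ x ≠ 0} : ℤ) = q ^ 4 - (q ^ 3 + q - q ^ 2) := by linarith
    rw [e1, e2]; ring
  exact (sum_eq_sum_iff_of_le hle).1 hsum v (by simp [hv])

theorem card_reps_mul {R : V → Prop} (hR : ∀ (a : F) (x : V), a ≠ 0 → R x → R (a • x))
    {I : Finset V} (h0 : ∀ s ∈ I, s ≠ 0) (hex : ∀ x, x ≠ 0 → R x → ∃ s ∈ I, ∃ a : F, x = a • s)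
    (hinj : ∀ s ∈ I, ∀ t ∈ I, ∀ a : F, t = a • s → t = s) :
    (Fintype.card F - 1) * #{s ∈ I | R s} = #{x : V | R x ∧ x ≠ 0} := by
  have hc : #({a : F | a ≠ 0} : Finset F) = Fintype.card F - 1 := by
    rw [filter_ne' univ (0 : F), card_erase_of_mem (mem_univ _), card_univ]
  rw [← hc, ← card_product]
  refine card_bij (fun z _ => z.1 • z.2) ?_ ?_ ?_
  · rintro ⟨a, s⟩ h
    simp only [mem_product, mem_filter, mem_univ, true_and] at h ⊢
    exact ⟨hR _ _ h.1 h.2.2, smul_ne_zero h.1 (h0 _ h.2.1)⟩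
  · rintro ⟨a, s⟩ h ⟨b, t⟩ h' hab
    simp only [mem_product, mem_filter, mem_univ, true_and] at h h' hab
    have hts : t = s := hinj s h.2.1 t h'.2.1 (b⁻¹ * a) (by
      rw [mul_smul, hab, inv_smul_smul₀ h'.1])
    subst hts
    rw [smul_left_injective F (h0 _ h.2.1) hab]
  · intro x hx
    simp only [mem_filter, mem_univ, true_and] at hx
    obtain ⟨s, hs, a, rfl⟩ := hex x hx.2 hx.1
    have ha : a ≠ 0 := by rintro rfl; simp at hx
    refine ⟨(a, s), ?_, rfl⟩
    simp only [mem_product, mem_filter, mem_univ, true_and]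
    refine ⟨ha, hs, ?_⟩
    have := hR a⁻¹ _ (inv_ne_zero ha) hx.1
    rwa [inv_smul_smul₀ ha] at this

variable (κ) in
/-- A set of representative vectors of the isotropic points. -/
structure IsIsotropicReps (I : Finset V) : Prop where
  ne_zero : ∀ s ∈ I, s ≠ 0
  isotropic : ∀ s ∈ I, κ s = 0
  exists_smul : ∀ x, x ≠ 0 → κ x = 0 → ∃ s ∈ I, ∃ a : F, x = a • s
  eq_of_smul : ∀ s ∈ I, ∀ t ∈ I, ∀ a : F, t = a • s → t = s

variable {I : Finset V}

theorem IsIsotropicReps.card_mul (hI : IsIsotropicReps κ I) (hE : IsElliptic κ q) {R : V → Prop}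
    (hR : ∀ (a : F) (x : V), a ≠ 0 → R x → R (a • x)) :
    (q - 1) * #{s ∈ I | R s} = #{x : V | (κ x = 0 ∧ x ≠ 0) ∧ R x} := by
  rw [← hE.card_field]
  have h := card_reps_mul (R := fun x => κ x = 0 ∧ R x) (I := I)
    (fun a x ha hx => ⟨by rw [QuadraticMap.map_smul, hx.1, smul_zero], hR a x ha hx.2⟩)
    hI.ne_zero (fun x hx hR => hI.exists_smul x hx hR.1) hI.eq_of_smul
  convert h using 2
  · congr 1
    ext s
    simp only [mem_filter]
    exact ⟨fun h => ⟨h.1, hI.isotropic s h.1, h.2⟩, fun h => ⟨h.1, h.2.2⟩⟩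
  · ext x; simp only [mem_filter]; tauto

omit [Fintype F] [Fintype V] in
theorem polar_smul_eq_zero (v : V) (a : F) (x : V) (h : polar κ v x = 0) :
    polar κ v (a • x) = 0 := by
  rw [polar_smul_right, h, smul_zero]

theorem IsIsotropicReps.card (hI : IsIsotropicReps κ I) (hE : IsElliptic κ q) :
    #I = q ^ 2 + 1 := by
  have h := hI.card_mul hE (R := fun _ => True) (fun _ _ _ h => h)
  have h1 := card_isotropic_ne_zero κ
  have h2 := hE.card_isotropic
  have hq := hE.one_lt
  simp only [and_true, filter_true] at h
  rw [← h] at h1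
  refine Nat.eq_of_mul_eq_mul_left (by omega : 0 < q - 1) ?_
  zify [hq.le] at *
  linarith

theorem IsIsotropicReps.card_perp (hI : IsIsotropicReps κ I) (hE : IsElliptic κ q) {v : V}
    (hv : κ v ≠ 0) : #{s ∈ I | polar κ v s = 0} = q + 1 := by
  have h := hI.card_mul hE (R := fun x => polar κ v x = 0)
    (fun a x _ => polar_smul_eq_zero v a x)
  have hq := hE.one_lt
  rw [hE.card_isotropic_perp hv] at h
  refine Nat.eq_of_mul_eq_mul_left (by omega : 0 < q - 1) ?_
  have : 1 ≤ q ^ 2 := Nat.one_le_pow _ _ (by omega)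
  zify [hq.le, this] at *
  linarith

theorem IsIsotropicReps.card_perp_isotropic (hI : IsIsotropicReps κ I) (hE : IsElliptic κ q)
    {v : V} (hv0 : v ≠ 0) (hv : κ v = 0) : #{s ∈ I | polar κ v s = 0} = 1 := by
  obtain ⟨s, hs, a, rfl⟩ := hI.exists_smul v hv0 hv
  have ha : a ≠ 0 := by rintro rfl; simp at hv0
  rw [card_eq_one]
  refine ⟨s, ?_⟩
  ext t
  simp only [mem_filter, mem_singleton, polar_smul_left, smul_eq_mul, mul_eq_zero, ha, false_or]
  constructor
  · rintro ⟨ht, hst⟩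
    obtain ⟨b, hb⟩ := hE.exists_eq_smul (hI.ne_zero s hs) (hI.isotropic s hs) (hI.isotropic t ht) hst
    exact hI.eq_of_smul s hs t ht b hb
  · rintro rfl
    exact ⟨hs, by rw [polar_self, hI.isotropic t hs, smul_zero]⟩

theorem IsIsotropicReps.card_perp_eq (hI : IsIsotropicReps κ I) (hE : IsElliptic κ q)
    {v : V} (hv0 : v ≠ 0) :
    #{s ∈ I | polar κ v s = 0} + q * (if κ v = 0 then 1 else 0) = q + 1 := by
  split_ifs with h
  · rw [hI.card_perp_isotropic hE hv0 h]; ring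
  · rw [hI.card_perp hE h]; ring

theorem IsIsotropicReps.card_common_add (hI : IsIsotropicReps κ I) (hE : IsElliptic κ q)
    {p r : V} (hp : κ p ≠ 0) (hr : κ r ≠ 0) (hpr : ∀ a : F, r ≠ a • p) :
    #{s ∈ I | polar κ p s = 0 ∧ polar κ r s = 0} + #{t : F | κ (p + t • r) = 0} = 2 := by
  have hp0 : p ≠ 0 := by rintro rfl; simp at hp
  have hne : ∀ t : F, p + t • r ≠ 0 := by
    intro t h
    have ht : t ≠ 0 := by rintro rfl; simp [hp0] at h
    apply hpr (-t⁻¹)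
    rw [eq_neg_of_add_eq_zero_left h, smul_neg, neg_smul, neg_neg, inv_smul_smul₀ ht]
  have hdc := sum_card_bipartiteAbove_eq_sum_card_bipartiteBelow
    (s := (univ : Finset F)) (t := I) (fun t s => polar κ (p + t • r) s = 0)
  simp only [bipartiteAbove, bipartiteBelow] at hdc
  have hl : ∑ t : F, #{s ∈ I | polar κ (p + t • r) s = 0} + q * #{t : F | κ (p + t • r) = 0} =
      q * (q + 1) := by
    rw [card_filter, mul_sum, ← sum_add_distrib,
      sum_congr rfl (fun t _ => hI.card_perp_eq hE (hne t)), sum_const, card_univ, hE.card_field,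
      smul_eq_mul]
  have hr' : ∑ s ∈ I, #{t : F | polar κ (p + t • r) s = 0} =
      #{s ∈ I | polar κ r s ≠ 0} + #{s ∈ I | polar κ p s = 0 ∧ polar κ r s = 0} * q := by
    rw [card_filter, card_filter, sum_mul, ← sum_add_distrib]
    refine sum_congr rfl fun s _ => ?_
    simp only [polar_add_left, polar_smul_left, smul_eq_mul]
    by_cases h : polar κ r s = 0
    · by_cases h' : polar κ p s = 0
      · simp [h, h', hE.card_field]
      · simp [h, h']
    · simp only [ne_eq, h, not_false_eq_true, if_true, and_false, if_false, zero_mul, add_zero]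
      rw [card_eq_one]
      refine ⟨-polar κ p s / polar κ r s, ?_⟩
      ext t
      simp only [mem_filter, mem_univ, true_and, mem_singleton]
      rw [eq_div_iff h]
      constructor <;> intro h <;> linear_combination h
  have h1 := hI.card_perp hE hr
  have h2 : #{s ∈ I | polar κ r s = 0} + #{s ∈ I | polar κ r s ≠ 0} = #I :=
    card_filter_add_card_filter_not _
  rw [hI.card hE, h1] at h2
  have hq := hE.one_lt
  refine Nat.eq_of_mul_eq_mul_left (by omega : 0 < q) ?_
  nlinarith [hdc, hl, hr', h2]

omit [Fintype F] [Fintype V] in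
theorem map_add_smul (p r : V) (t : F) :
    κ (p + t • r) = κ p + t * polar κ p r + t ^ 2 * κ r := by
  rw [QuadraticMap.map_add κ, QuadraticMap.map_smul, polar_smul_right]
  simp only [smul_eq_mul]; ring

omit [Fintype V] in
theorem eq_sq_mul_of_card_le_one {p r : V} (hp : κ p ≠ 0) (hr : κ r ≠ 0)
    (hj : #{t : F | κ (p + t • r) = 0} ≤ 1) {t : F} (ht : κ (p + t • r) = 0) :
    κ p = t ^ 2 * κ r := by
  have ht0 : t ≠ 0 := by rintro rfl; simp [hp] at ht
  rw [card_le_one] at hj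
  have h := hj t (by simp [ht]) (κ p / (κ r * t)) (by
    rw [map_add_smul] at ht
    simp only [mem_filter, mem_univ, true_and]
    rw [map_add_smul]
    field_simp
    linear_combination (κ p) * ht)
  field_simp at h
  linear_combination -h

theorem IsIsotropicReps.card_common_of_not_isSquare (hI : IsIsotropicReps κ I)
    (hE : IsElliptic κ q) {p r : V} (hp : κ p ≠ 0) (hr : κ r ≠ 0)
    (hsq : ∀ c : F, κ p ≠ c ^ 2 * κ r)
    (hpr : ∃ s ∈ I, polar κ p s = 0 ∧ polar κ r s = 0) :
    #{s ∈ I | polar κ p s = 0 ∧ polar κ r s = 0} = 2 := by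
  have hne : ∀ a : F, r ≠ a • p := by
    rintro a rfl
    have ha : a ≠ 0 := by rintro rfl; simp at hr
    apply hsq a⁻¹
    rw [QuadraticMap.map_smul, smul_eq_mul]; field_simp
  have h := hI.card_common_add hE hp hr hne
  obtain ⟨s, hs, hs'⟩ := hpr
  have hpos : 0 < #{s ∈ I | polar κ p s = 0 ∧ polar κ r s = 0} :=
    card_pos.2 ⟨s, mem_filter.2 ⟨hs, hs'⟩⟩
  have h0 : #{t : F | κ (p + t • r) = 0} = 0 := by
    rw [card_eq_zero, filter_eq_empty_iff]
    intro t _ ht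
    exact hsq t (eq_sq_mul_of_card_le_one hp hr (by omega) ht)
  omega

theorem IsIsotropicReps.card_proportional (hI : IsIsotropicReps κ I)
    (hE : IsElliptic κ q) {p r : V} (hp : κ p ≠ 0) {c : F} (hc : c ≠ 0)
    (hsq : κ r = c ^ 2 * κ p) (hne : r = p ∨ ∀ a : F, r ≠ a • p)
    (hpr : ∃ s ∈ I, polar κ p s = 0 ∧ polar κ r s = 0) :
    (#{s ∈ I | (polar κ p s ≠ 0 ∧ polar κ r s ≠ 0) ∧
        polar κ p s ^ 2 * κ r = polar κ r s ^ 2 * κ p} : ℤ) =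
      2 + (q - 2) * #{s ∈ I | polar κ p s = 0 ∧ polar κ r s = 0} := by
  rcases hne with rfl | hne
  · have h1 := hI.card_perp hE hp
    have h2 : #{s ∈ I | polar κ r s = 0} + #{s ∈ I | polar κ r s ≠ 0} = #I :=
      card_filter_add_card_filter_not _
    rw [hI.card hE, h1] at h2
    simp only [and_self, and_true, h1]
    zify at h2
    push_cast
    linarith
  have hr : κ r ≠ 0 := by rw [hsq]; exact mul_ne_zero (pow_ne_zero 2 hc) hp
  have h := hI.card_common_add hE hp hr hne
  obtain ⟨s, hs, hs'⟩ := hpr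
  have hpos : 0 < #{s ∈ I | polar κ p s = 0 ∧ polar κ r s = 0} :=
    card_pos.2 ⟨s, mem_filter.2 ⟨hs, hs'⟩⟩
  have hne0 : ∀ d : F, d ≠ 0 → p + d • r ≠ 0 := by
    intro t ht h
    apply hne (-t⁻¹)
    rw [eq_neg_of_add_eq_zero_left h, smul_neg, neg_smul, neg_neg, inv_smul_smul₀ ht]
  have hcc : c⁻¹ ≠ -c⁻¹ := by
    intro h
    have : (2 : F) * c⁻¹ = 0 := by linear_combination h
    simp [hE.two_ne_zero, hc] at this
  have hj : #{t : F | κ (p + t • r) = 0} =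
      (if κ (p + c⁻¹ • r) = 0 then 1 else 0) + (if κ (p + (-c⁻¹) • r) = 0 then 1 else 0) := by
    have : ({t : F | κ (p + t • r) = 0} : Finset F) =
        ({c⁻¹, -c⁻¹} : Finset F).filter (fun t => κ (p + t • r) = 0) := by
      ext t
      simp only [mem_filter, mem_univ, true_and, mem_insert, mem_singleton, iff_and_self]
      intro ht
      have h1 := eq_sq_mul_of_card_le_one hp hr (by omega) ht
      rw [hsq] at h1
      have h2 : (t - c⁻¹) * (t + c⁻¹) = 0 := by
        field_simp
        refine mul_right_cancel₀ hp ?_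
        linear_combination -h1
      rcases mul_eq_zero.1 h2 with h | h
      · exact Or.inl (sub_eq_zero.1 h)
      · exact Or.inr (eq_neg_of_add_eq_zero_left h)
    rw [this, card_filter, sum_pair hcc]
  have hN : #{s ∈ I | (polar κ p s ≠ 0 ∧ polar κ r s ≠ 0) ∧
        polar κ p s ^ 2 * κ r = polar κ r s ^ 2 * κ p} +
      2 * #{s ∈ I | polar κ p s = 0 ∧ polar κ r s = 0} =
      #{s ∈ I | polar κ (p + c⁻¹ • r) s = 0} + #{s ∈ I | polar κ (p + (-c⁻¹) • r) s = 0} := by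
    simp only [card_filter, mul_sum]
    rw [← sum_add_distrib, ← sum_add_distrib]
    refine sum_congr rfl fun s _ => ?_
    simp only [polar_add_left, polar_smul_left, smul_eq_mul, hsq]
    generalize polar κ p s = x
    generalize polar κ r s = y
    have e : x ^ 2 * (c ^ 2 * κ p) = y ^ 2 * κ p ↔ x + c⁻¹ * y = 0 ∨ x + -c⁻¹ * y = 0 := by
      rw [← mul_eq_zero, ← mul_assoc, mul_left_inj' hp, ← sub_eq_zero]
      have : x ^ 2 * c ^ 2 - y ^ 2 = c ^ 2 * ((x + c⁻¹ * y) * (x + -c⁻¹ * y)) := by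
        field_simp; ring
      rw [this, mul_eq_zero]
      simp [hc]
    rw [e]
    by_cases hx : x = 0
    · by_cases hy : y = 0
      · simp [hx, hy]
      · simp [hx, hy, hc]
    · by_cases hy : y = 0
      · simp [hx, hy]
      · by_cases h1 : x + c⁻¹ * y = 0
        · have h2 : ¬ x + -c⁻¹ * y = 0 := by
            intro h2
            have : (2 : F) * x = 0 := by linear_combination h1 + h2
            simp [hE.two_ne_zero, hx] at this
          simp [hx, hy, h1, show ¬ x + -(c⁻¹ * y) = 0 by simpa using h2]
        · simp [hx, hy, h1]
  have e1 := hI.card_perp_eq hE (hne0 c⁻¹ (inv_ne_zero hc))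
  have e2 := hI.card_perp_eq hE (hne0 (-c⁻¹) (neg_ne_zero.2 (inv_ne_zero hc)))
  rw [hj] at h
  zify at e1 e2 h hN
  linear_combination hN + e1 + e2 - q * h

theorem sum_sum_card_filter {α β γ : Type*} (X : Finset α) (Y : Finset β) (I : Finset γ)
    (T : α → β → γ → Prop) [∀ p r s, Decidable (T p r s)] :
    ∑ p ∈ X, ∑ r ∈ Y, #{s ∈ I | T p r s} = ∑ s ∈ I, #{z ∈ X ×ˢ Y | T z.1 z.2 s} := by
  rw [← sum_product']
  exact sum_card_bipartiteAbove_eq_sum_card_bipartiteBelow (s := X ×ˢ Y) (t := I)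
    (fun z s => T z.1 z.2 s)

theorem card_filter_mul_card_filter {α β : Type*} (X : Finset α) (Y : Finset β) (P : α → Prop)
    (Q : β → Prop) [DecidablePred P] [DecidablePred Q]
    [DecidablePred fun z : α × β => P z.1 ∧ Q z.2] :
    #{p ∈ X | P p} * #{r ∈ Y | Q r} = #{z ∈ X ×ˢ Y | P z.1 ∧ Q z.2} := by
  rw [← card_product]
  congr 1
  ext
  simp only [mem_filter, mem_product]
  tauto

omit [AddCommGroup V] [Module F V] [Fintype V] in
theorem two_mul_card_filter_sq_le (h2 : (2 : F) ≠ 0) (A : Finset V) (φ : V → F)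
    (hφ : ∀ p ∈ A, ∃ c : F, c ≠ 0 ∧ φ p = c ^ 2) :
    2 * #A ^ 2 ≤ (Fintype.card F - 1) * #{z ∈ A ×ˢ A | φ z.1 = φ z.2} := by
  set N : Finset F := univ.filter (fun c => c ≠ 0) with hN
  have hc : #N = Fintype.card F - 1 := by
    rw [hN, filter_ne' univ (0 : F), card_erase_of_mem (mem_univ _), card_univ]
  set C := N.image (fun c => c ^ 2) with hC
  have h1 : 2 * #C ≤ #N := by
    refine mul_card_image_le_card N 2 ?_
    intro a ha
    obtain ⟨c, hcN, rfl⟩ := mem_image.1 ha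
    have hc0 : c ≠ 0 := by simpa [hN] using hcN
    have hne : c ≠ -c := by
      intro h
      have : (2 : F) * c = 0 := by linear_combination h
      simp [h2, hc0] at this
    refine (card_le_card ?_).trans' (card_pair hne).symm.le
    intro x hx
    rcases mem_insert.1 hx with rfl | hx
    · exact mem_filter.2 ⟨hcN, rfl⟩
    · rw [mem_singleton] at hx
      subst hx
      refine mem_filter.2 ⟨by simpa [hN] using hc0, by ring⟩
  have hmap : ∀ p ∈ A, φ p ∈ C := by
    intro p hp
    obtain ⟨c, hc, h⟩ := hφ p hp
    exact mem_image.2 ⟨c, by simpa [hN] using hc, h.symm⟩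
  have h3 : #A = ∑ a ∈ C, #{p ∈ A | φ p = a} := card_eq_sum_card_fiberwise hmap
  have h4 : #{z ∈ A ×ˢ A | φ z.1 = φ z.2} = ∑ a ∈ C, #{p ∈ A | φ p = a} ^ 2 := by
    rw [card_eq_sum_card_fiberwise (f := fun z => φ z.1) (t := C)
      (fun z hz => hmap _ (mem_product.1 (mem_filter.1 hz).1).1)]
    refine sum_congr rfl fun a _ => ?_
    rw [_root_.sq, ← card_product]
    congr 1
    ext z
    simp only [mem_filter, mem_product]
    constructor
    · rintro ⟨⟨h, h'⟩, rfl⟩; exact ⟨⟨h.1, rfl⟩, h.2, h'.symm⟩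
    · rintro ⟨⟨ha, hl⟩, hb, hr⟩; exact ⟨⟨⟨ha, hb⟩, hl.trans hr.symm⟩, hl⟩
  rw [h4, ← hc]
  calc 2 * #A ^ 2 = 2 * (∑ a ∈ C, #{p ∈ A | φ p = a}) ^ 2 := by rw [h3]
    _ ≤ 2 * (#C * ∑ a ∈ C, #{p ∈ A | φ p = a} ^ 2) :=
        Nat.mul_le_mul_left _ sq_sum_le_card_mul_sum_sq
    _ ≤ _ := by rw [← mul_assoc]; exact Nat.mul_le_mul_right _ h1

theorem IsIsotropicReps.sum_card_perp (hI : IsIsotropicReps κ I) (hE : IsElliptic κ q)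
    {X : Finset V} (hX : ∀ p ∈ X, κ p ≠ 0) :
    ∑ s ∈ I, #{p ∈ X | polar κ p s = 0} = #X * (q + 1) := by
  have h := sum_card_bipartiteAbove_eq_sum_card_bipartiteBelow
    (s := X) (t := I) (fun p s => polar κ p s = 0)
  simp only [bipartiteAbove, bipartiteBelow] at h
  rw [← h, sum_congr rfl (fun p hp => hI.card_perp hE (hX p hp)), sum_const, smul_eq_mul]

variable (κ I) in
/-- Representatives of pairwise intersecting circles. -/
structure IsIntersecting (X : Finset V) : Prop where
  ne_zero : ∀ p ∈ X, κ p ≠ 0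
  eq_or : ∀ p ∈ X, ∀ r ∈ X, r = p ∨ ∀ a : F, r ≠ a • p
  inter : ∀ p ∈ X, ∀ r ∈ X, ∃ s ∈ I, polar κ p s = 0 ∧ polar κ r s = 0

omit [Fintype F] [Fintype V] in
theorem IsIntersecting.subset {X Y : Finset V} (hX : IsIntersecting κ I X) (h : Y ⊆ X) :
    IsIntersecting κ I Y :=
  ⟨fun p hp => hX.ne_zero p (h hp), fun p hp r hr => hX.eq_or p (h hp) r (h hr),
    fun p hp r hr => hX.inter p (h hp) r (h hr)⟩

theorem IsIntersecting.two_mul_sq_le_of_class {X : Finset V} (hX : IsIntersecting κ I X)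
    (hI : IsIsotropicReps κ I) (hE : IsElliptic κ q) (hq : 3 < q)
    (hcl : ∀ p ∈ X, ∀ r ∈ X, ∃ c : F, c ≠ 0 ∧ κ r = c ^ 2 * κ p) :
    2 * #X ^ 2 ≤ ∑ s ∈ I, #{p ∈ X | polar κ p s = 0} ^ 2 := by
  have hs : ∀ s ∈ I, 2 * #{p ∈ X | polar κ p s ≠ 0} ^ 2 ≤ (q - 1) *
      #{z ∈ X ×ˢ X | (polar κ z.1 s ≠ 0 ∧ polar κ z.2 s ≠ 0) ∧
        polar κ z.1 s ^ 2 * κ z.2 = polar κ z.2 s ^ 2 * κ z.1} := by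
    intro s _
    rcases X.eq_empty_or_nonempty with rfl | ⟨p₀, hp₀⟩
    · simp
    have hp₀' := hX.ne_zero p₀ hp₀
    have h := two_mul_card_filter_sq_le hE.two_ne_zero ({p ∈ X | polar κ p s ≠ 0} : Finset V)
      (fun p => polar κ p s ^ 2 / (κ p * κ p₀)) (by
        intro p hp
        rw [mem_filter] at hp
        obtain ⟨c, hc, h⟩ := hcl p₀ hp₀ p hp.1
        refine ⟨polar κ p s / (c * κ p₀), div_ne_zero hp.2 (mul_ne_zero hc hp₀'), ?_⟩
        rw [h]; field_simp)
    rw [hE.card_field] at h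
    convert h using 3
    ext ⟨p, r⟩
    simp only [mem_filter, mem_product]
    constructor
    · rintro ⟨⟨h1, h2⟩, ⟨h3, h4⟩, h5⟩
      have := hX.ne_zero p h1
      have := hX.ne_zero r h2
      refine ⟨⟨⟨h1, h3⟩, h2, h4⟩, ?_⟩
      field_simp
      linear_combination h5
    · rintro ⟨⟨⟨h1, h3⟩, h2, h4⟩, h5⟩
      have := hX.ne_zero p h1
      have := hX.ne_zero r h2
      refine ⟨⟨h1, h2⟩, ⟨h3, h4⟩, ?_⟩
      field_simp at h5
      linear_combination h5
  have hsum := sum_le_sum hs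
  have hT := sum_sum_card_filter X X I (fun p r s => (polar κ p s ≠ 0 ∧ polar κ r s ≠ 0) ∧
        polar κ p s ^ 2 * κ r = polar κ r s ^ 2 * κ p)
  have hsum : 2 * ∑ s ∈ I, #{p ∈ X | polar κ p s ≠ 0} ^ 2 ≤ (q - 1) *
      ∑ p ∈ X, ∑ r ∈ X, #{s ∈ I | (polar κ p s ≠ 0 ∧ polar κ r s ≠ 0) ∧
        polar κ p s ^ 2 * κ r = polar κ r s ^ 2 * κ p} := by
    rw [mul_sum]
    refine hsum.trans_eq ?_
    rw [← mul_sum]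
    congr 1
    convert hT.symm
  have hM : ∑ s ∈ I, #{p ∈ X | polar κ p s = 0} ^ 2 =
      ∑ p ∈ X, ∑ r ∈ X, #{s ∈ I | polar κ p s = 0 ∧ polar κ r s = 0} := by
    rw [sum_sum_card_filter X X I (fun p r s => polar κ p s = 0 ∧ polar κ r s = 0)]
    refine sum_congr rfl fun s _ => ?_
    rw [_root_.sq, card_filter_mul_card_filter]
  have hf := hI.sum_card_perp hE hX.ne_zero
  have hcI := hI.card hE
  have hN : ((∑ p ∈ X, ∑ r ∈ X, #{s ∈ I | (polar κ p s ≠ 0 ∧ polar κ r s ≠ 0) ∧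
        polar κ p s ^ 2 * κ r = polar κ r s ^ 2 * κ p} : ℕ) : ℤ) =
      2 * #X ^ 2 + (q - 2) * (∑ s ∈ I, #{p ∈ X | polar κ p s = 0} ^ 2 : ℕ) := by
    rw [hM]
    push_cast
    have : ∀ p ∈ X, ∀ r ∈ X, (#{s ∈ I | (polar κ p s ≠ 0 ∧ polar κ r s ≠ 0) ∧
        polar κ p s ^ 2 * κ r = polar κ r s ^ 2 * κ p} : ℤ) =
        2 + (q - 2) * #{s ∈ I | polar κ p s = 0 ∧ polar κ r s = 0} := fun p hp r hr => by
      obtain ⟨c, hc, h⟩ := hcl p hp r hr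
      exact hI.card_proportional hE (hX.ne_zero p hp) hc h (hX.eq_or p hp r hr)
        (hX.inter p hp r hr)
    rw [sum_congr rfl fun p hp => sum_congr rfl fun r hr => this p hp r hr]
    simp only [sum_add_distrib, sum_const, ← mul_sum, nsmul_eq_mul]
    ring
  have hcompl : ((∑ s ∈ I, #{p ∈ X | polar κ p s ≠ 0} ^ 2 : ℕ) : ℤ) =
      (q ^ 2 + 1) * #X ^ 2 - 2 * #X * (#X * (q + 1)) +
        (∑ s ∈ I, #{p ∈ X | polar κ p s = 0} ^ 2 : ℕ) := by
    have h1 : ∀ s ∈ I, ((#{p ∈ X | polar κ p s ≠ 0} : ℤ)) ^ 2 =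
        #X ^ 2 - 2 * #X * #{p ∈ X | polar κ p s = 0} + #{p ∈ X | polar κ p s = 0} ^ 2 := by
      intro s _
      have : #{p ∈ X | polar κ p s = 0} + #{p ∈ X | polar κ p s ≠ 0} = #X :=
        card_filter_add_card_filter_not _
      rw [← this]; push_cast; ring
    push_cast
    rw [sum_congr rfl h1, sum_add_distrib, sum_sub_distrib, ← mul_sum, sum_const, hcI]
    zify at hf
    rw [hf]; simp
  generalize ∑ s ∈ I, #{p ∈ X | polar κ p s = 0} ^ 2 = M at *
  zify [hE.one_lt.le] at hsum ⊢
  push_cast at hN hcompl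
  rw [hN, hcompl] at hsum
  have hq' : (3 : ℤ) < q := by exact_mod_cast hq
  have hpos : (0 : ℤ) < q * (q - 3) := mul_pos (by linarith) (by linarith)
  refine le_of_mul_le_mul_left ?_ hpos
  linarith

theorem isSquare_div_of_not_isSquare {a b : F} (ha : ¬ IsSquare a) (hb : ¬ IsSquare b) :
    IsSquare (a / b) := by
  have hb0 : b ≠ 0 := by rintro rfl; simp at hb
  have ha0 : a ≠ 0 := by rintro rfl; simp at ha
  have h1 := quadraticChar_neg_one_iff_not_isSquare.2 ha
  have h2 := quadraticChar_neg_one_iff_not_isSquare.2 hb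
  have h3 : quadraticChar F (a * b) = 1 := by rw [map_mul, h1, h2]; norm_num
  rw [quadraticChar_one_iff_isSquare (mul_ne_zero ha0 hb0)] at h3
  obtain ⟨c, hc⟩ := h3
  refine ⟨c / b, ?_⟩
  field_simp
  linear_combination hc

theorem IsIntersecting.two_mul_sq_le {X : Finset V} (hX : IsIntersecting κ I X)
    (hI : IsIsotropicReps κ I) (hE : IsElliptic κ q) (hq : 3 < q) :
    2 * #X ^ 2 ≤ ∑ s ∈ I, #{p ∈ X | polar κ p s = 0} ^ 2 := by
  set Y := X.filter (fun p => IsSquare (κ p)) with hY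
  set Z := X.filter (fun p => ¬ IsSquare (κ p)) with hZ
  have hYX : Y ⊆ X := filter_subset _ _
  have hZX : Z ⊆ X := filter_subset _ _
  have h1 := (hX.subset hYX).two_mul_sq_le_of_class hI hE hq (by
    intro p hp r hr
    have hp0 := hX.ne_zero p (hYX hp)
    have hr0 := hX.ne_zero r (hYX hr)
    obtain ⟨a, ha⟩ := (mem_filter.1 hp).2
    obtain ⟨b, hb⟩ := (mem_filter.1 hr).2
    have ha0 : a ≠ 0 := by rintro rfl; simp [ha] at hp0
    have hb0 : b ≠ 0 := by rintro rfl; simp [hb] at hr0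
    refine ⟨b / a, div_ne_zero hb0 ha0, ?_⟩
    rw [ha, hb]; field_simp)
  have h2 := (hX.subset hZX).two_mul_sq_le_of_class hI hE hq (by
    intro p hp r hr
    have hp0 := hX.ne_zero p (hZX hp)
    have hr0 := hX.ne_zero r (hZX hr)
    obtain ⟨c, hc⟩ := isSquare_div_of_not_isSquare (mem_filter.1 hr).2 (mem_filter.1 hp).2
    have h : κ r = c ^ 2 * κ p := by
      rw [div_eq_iff hp0] at hc; rw [hc]; ring
    refine ⟨c, ?_, h⟩
    rintro rfl; simp [hr0] at h)
  have h3 : ∑ s ∈ I, #{p ∈ Y | polar κ p s = 0} * #{p ∈ Z | polar κ p s = 0} =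
      2 * (#Y * #Z) := by
    have : ∑ p ∈ Y, ∑ r ∈ Z, #{s ∈ I | polar κ p s = 0 ∧ polar κ r s = 0} =
        ∑ p ∈ Y, ∑ r ∈ Z, 2 := by
      refine sum_congr rfl fun p hp => sum_congr rfl fun r hr => ?_
      have hr0 := hX.ne_zero r (hZX hr)
      refine hI.card_common_of_not_isSquare hE (hX.ne_zero p (hYX hp)) hr0 ?_
        (hX.inter p (hYX hp) r (hZX hr))
      intro c h
      apply (mem_filter.1 hr).2
      obtain ⟨a, ha⟩ := (mem_filter.1 hp).2
      have hc0 : c ≠ 0 := by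
        rintro rfl; exact hX.ne_zero p (hYX hp) (by simpa using h)
      refine ⟨a / c, ?_⟩
      field_simp
      linear_combination ha - h
    rw [sum_sum_card_filter Y Z I (fun p r s => polar κ p s = 0 ∧ polar κ r s = 0)] at this
    simp only [sum_const, smul_eq_mul] at this
    rw [← mul_assoc, mul_comm 2, mul_assoc, mul_comm 2, ← this]
    refine sum_congr rfl fun s _ => ?_
    rw [card_filter_mul_card_filter]
  have h4 : #Y + #Z = #X := card_filter_add_card_filter_not _
  have h5 : ∀ s ∈ I, #{p ∈ X | polar κ p s = 0} ^ 2 = #{p ∈ Y | polar κ p s = 0} ^ 2 +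
      #{p ∈ Z | polar κ p s = 0} ^ 2 +
      2 * (#{p ∈ Y | polar κ p s = 0} * #{p ∈ Z | polar κ p s = 0}) := by
    intro s _
    have : #{p ∈ Y | polar κ p s = 0} + #{p ∈ Z | polar κ p s = 0} =
        #{p ∈ X | polar κ p s = 0} := by
      have hY' : Y.filter (fun p => polar κ p s = 0) =
          (X.filter fun p => polar κ p s = 0).filter (fun p => IsSquare (κ p)) := by
        ext; simp only [hY, mem_filter]; tauto
      have hZ' : Z.filter (fun p => polar κ p s = 0) =
          (X.filter fun p => polar κ p s = 0).filter (fun p => ¬ IsSquare (κ p)) := by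
        ext; simp only [hZ, mem_filter]; tauto
      rw [hY', hZ']
      exact card_filter_add_card_filter_not _
    rw [← this]; ring
  rw [sum_congr rfl h5, sum_add_distrib, sum_add_distrib, ← mul_sum, h3, ← h4]
  nlinarith [h1, h2]

theorem IsIsotropicReps.eq_of_polar_eq_zero (hI : IsIsotropicReps κ I) (hE : IsElliptic κ q)
    {s t : V} (hs : s ∈ I) (ht : t ∈ I) (h : polar κ s t = 0) : t = s := by
  obtain ⟨a, ha⟩ := hE.exists_eq_smul (hI.ne_zero s hs) (hI.isotropic s hs) (hI.isotropic t ht) h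
  exact hI.eq_of_smul s hs t ht a ha

omit [Fintype F] [Fintype V] in
theorem polar_smul_add_smul (x s t : V) (a b : F) :
    polar κ x (a • s + b • t) = a * polar κ x s + b * polar κ x t := by
  rw [polar_add_right, polar_smul_right, polar_smul_right, smul_eq_mul, smul_eq_mul]

omit [Fintype F] [Fintype V] in
theorem map_smul_add_smul (s t : V) (a b : F) :
    κ (a • s + b • t) = a ^ 2 * κ s + a * b * polar κ s t + b ^ 2 * κ t := by
  rw [map_add_smul, QuadraticMap.map_smul, polar_smul_left]
  simp only [smul_eq_mul]; ring

omit [Fintype F] [Fintype V] in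
theorem IsIsotropicReps.exists_mem_secant (hI : IsIsotropicReps κ I) {s p : V} (hs : s ∈ I)
    (hp : polar κ s p ≠ 0) : ∃ t ∈ I, t ≠ s ∧ ∃ a b : F, p = a • s + b • t := by
  have hss : polar κ s s = 0 := by rw [polar_self, hI.isotropic s hs, smul_zero]
  have hv : polar κ s (κ p • s + (-polar κ s p) • p) ≠ 0 := by
    rw [polar_smul_add_smul, hss]
    simpa using hp
  obtain ⟨t, ht, c, hc⟩ := hI.exists_smul (κ p • s + (-polar κ s p) • p)
    (by intro h; rw [h, polar_zero_right] at hv; exact hv rfl)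
    (by rw [map_smul_add_smul, hI.isotropic s hs]; ring)
  refine ⟨t, ht, ?_, (polar κ s p)⁻¹ * κ p, -((polar κ s p)⁻¹ * c), ?_⟩
  · rintro rfl
    rw [hc, polar_smul_right, hss, smul_zero] at hv
    exact hv rfl
  · rw [neg_smul, mul_smul, mul_smul, ← hc, ← sub_eq_add_neg, ← smul_sub, neg_smul,
      sub_add_cancel_left, neg_neg, inv_smul_smul₀ hp]

theorem IsIsotropicReps.eq_of_secant (hI : IsIsotropicReps κ I) (hE : IsElliptic κ q)
    {s t t' : V} (hs : s ∈ I) (ht : t ∈ I) (ht' : t' ∈ I) (hts : t ≠ s) {a b a' b' : F}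
    (hb : b ≠ 0) (h : a • s + b • t = a' • s + b' • t') : t' = t := by
  have hst : polar κ s t ≠ 0 := fun h => hts (hI.eq_of_polar_eq_zero hE hs ht h)
  have h2 : (a - a') • s + b • t = b' • t' := by
    rw [sub_smul, sub_add_eq_add_sub, h, add_sub_cancel_left]
  have h3 : κ ((a - a') • s + b • t) = κ (b' • t') := by rw [h2]
  rw [QuadraticMap.map_smul, map_smul_add_smul, hI.isotropic s hs, hI.isotropic t ht,
    hI.isotropic t' ht'] at h3
  have h4 : a - a' = 0 := by simpa [hb, hst] using h3
  rw [h4, zero_smul, zero_add] at h2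
  refine (hI.eq_of_smul t' ht' t ht (b⁻¹ * b') ?_).symm
  rw [mul_smul, ← h2, inv_smul_smul₀ hb]

variable (F) in
/-- The pairs of points of `I` whose secant line meets no element of `X`. -/
def missedSecants (I X : Finset V) : SimpleGraph I where
  Adj s t := s ≠ t ∧ ∀ p ∈ X, ¬ ∃ a b : F, p = a • (s : V) + b • (t : V)
  symm := ⟨fun s t h => ⟨h.1.symm, fun p hp ⟨a, b, hab⟩ => h.2 p hp ⟨b, a, by rw [hab, add_comm]⟩⟩⟩
  loopless := ⟨fun s h => h.1 rfl⟩

theorem IsIntersecting.card_secants {X : Finset V} (hX : IsIntersecting κ I X)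
    (hI : IsIsotropicReps κ I) (hE : IsElliptic κ q) {s : V} (hs : s ∈ I) :
    #{t ∈ I | t ≠ s ∧ ∃ p ∈ X, ∃ a b : F, p = a • s + b • t} = #{p ∈ X | polar κ p s ≠ 0} := by
  have hss : polar κ s s = 0 := by rw [polar_self, hI.isotropic s hs, smul_zero]
  refine le_antisymm ?_ ?_
  · refine card_le_card_of_forall_subsingleton (fun t p => ∃ a b : F, p = a • s + b • t) ?_ ?_
    · intro t ht
      obtain ⟨ht, hts, p, hp, a, b, rfl⟩ := mem_filter.1 ht
      refine ⟨_, mem_filter.2 ⟨hp, ?_⟩, a, b, rfl⟩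
      have := hX.ne_zero _ hp
      rw [map_smul_add_smul, hI.isotropic s hs, hI.isotropic t ht] at this
      rw [polar_comm, polar_smul_add_smul, hss]
      intro h
      apply this
      linear_combination a * h
    · rintro p hp t ⟨ht, a, b, h⟩ t' ⟨ht', a', b', h'⟩
      rw [mem_filter] at ht ht' hp
      refine (hI.eq_of_secant hE hs ht.1 ht'.1 ht.2.1 ?_ (h.symm.trans h')).symm
      rintro rfl
      apply hp.2
      rw [h, zero_smul, add_zero, polar_smul_left, hss, smul_zero]
  · refine card_le_card_of_forall_subsingleton (fun p t => ∃ a b : F, p = a • s + b • t) ?_ ?_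
    · intro p hp
      rw [mem_filter, polar_comm] at hp
      obtain ⟨t, ht, hts, a, b, h⟩ := hI.exists_mem_secant hs hp.2
      exact ⟨t, mem_filter.2 ⟨ht, hts, p, hp.1, a, b, h⟩, a, b, h⟩
    · rintro t ht p ⟨hp, a, b, rfl⟩ r ⟨hr, a', b', rfl⟩
      rw [mem_filter] at ht hp hr
      refine ((hX.eq_or _ hp.1 _ hr.1).resolve_right fun hne => ?_).symm
      obtain ⟨w, hw, hpw, hrw⟩ := hX.inter _ hp.1 _ hr.1
      have hb : b ≠ 0 := by
        rintro rfl
        apply hp.2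
        rw [polar_comm, polar_smul_add_smul, hss]; ring
      have hD : a * b' - a' * b ≠ 0 := by
        intro hD
        apply hne (b' / b)
        rw [smul_add, smul_smul, smul_smul, div_mul_cancel₀ _ hb]
        congr 2
        field_simp
        linear_combination -hD
      rw [polar_comm, polar_smul_add_smul, polar_comm, polar_comm κ w] at hpw hrw
      have h1 : polar κ s w = 0 := by
        refine (mul_eq_zero.1 (?_ : (a * b' - a' * b) * _ = 0)).resolve_left hD
        linear_combination b' * hpw - b * hrw
      have h2 : polar κ t w = 0 := by
        refine (mul_eq_zero.1 (?_ : (a * b' - a' * b) * _ = 0)).resolve_left hD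
        linear_combination a * hrw - a' * hpw
      exact ht.2.1 ((hI.eq_of_polar_eq_zero hE ht.1 hw h2).symm.trans
        (hI.eq_of_polar_eq_zero hE hs hw h1))

theorem IsIntersecting.degree_missedSecants {X : Finset V} (hX : IsIntersecting κ I X)
    (hI : IsIsotropicReps κ I) (hE : IsElliptic κ q) (s : I) :
    (missedSecants F I X).degree s + #X = q ^ 2 + #{p ∈ X | polar κ p s = 0} := by
  have h1 : (missedSecants F I X).degree s =
      #{t ∈ I | t ≠ (s : V) ∧ ¬ ∃ p ∈ X, ∃ a b : F, p = a • (s : V) + b • t} := by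
    rw [← SimpleGraph.card_neighborFinset_eq_degree]
    refine card_bij (fun t _ => t) ?_ (fun _ _ _ _ h => Subtype.ext h) ?_
    · intro t ht
      obtain ⟨h, h'⟩ := (SimpleGraph.mem_neighborFinset _ _ _).1 ht
      refine mem_filter.2 ⟨t.2, fun h2 => h (Subtype.ext h2.symm), ?_⟩
      rintro ⟨p, hp, h2⟩
      exact h' p hp h2
    · intro t ht
      obtain ⟨ht, hts, h⟩ := mem_filter.1 ht
      refine ⟨⟨t, ht⟩, (SimpleGraph.mem_neighborFinset _ _ _).2 ⟨?_, ?_⟩, rfl⟩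
      · rintro rfl; exact hts rfl
      · exact fun p hp h' => h ⟨p, hp, h'⟩
  have h2 := hX.card_secants hI hE s.2
  have h3 : #{t ∈ I | t ≠ (s : V) ∧ ∃ p ∈ X, ∃ a b : F, p = a • (s : V) + b • t} +
      #{t ∈ I | t ≠ (s : V) ∧ ¬ ∃ p ∈ X, ∃ a b : F, p = a • (s : V) + b • t} = #(I.erase s) := by
    rw [← filter_ne', ← filter_filter, ← filter_filter]
    exact card_filter_add_card_filter_not _
  have h4 : #{p ∈ X | polar κ p s = 0} + #{p ∈ X | polar κ p s ≠ 0} = #X :=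
    card_filter_add_card_filter_not _
  rw [card_erase_of_mem s.2, hI.card hE] at h3
  omega

/-- An intersecting family of at least `q (q + 1)` circles has a common point. -/
theorem IsIntersecting.exists_forall_polar_eq_zero {X : Finset V} (hX : IsIntersecting κ I X)
    (hI : IsIsotropicReps κ I) (hE : IsElliptic κ q) (hq : 3 < q) (hle : q * (q + 1) ≤ #X) :
    #X = q * (q + 1) ∧ ∃ s ∈ I, ∀ p ∈ X, polar κ p s = 0 := by
  have hsq := hX.two_mul_sq_le hI hE hq
  have hlin := hI.sum_card_perp hE hX.ne_zero
  have hcI := hI.card hE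
  have hdeg := hX.degree_missedSecants hI hE
  set G := missedSecants F I X
  have hG1 := G.sum_degrees_eq_twice_card_edges
  have hG2 := sum_degree_sq_le G
  have hG3 := exists_degree_eq_card_edgeFinset G
  set e := #G.edgeFinset
  rw [← sum_coe_sort] at hsq hlin
  have hcI' : Fintype.card I = q ^ 2 + 1 := by rw [Fintype.card_coe, hcI]
  have hdeg' : ∀ s : I, (G.degree s : ℤ) = (q ^ 2 - #X) + #{p ∈ X | polar κ p s = 0} := by
    intro s
    have := hdeg s
    zify at this
    linarith
  have hS1 : (2 * e : ℤ) = (q ^ 2 + 1) * (q ^ 2 - #X) + #X * (q + 1) := by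
    zify at hG1 hlin
    rw [← hG1, sum_congr rfl fun s _ => hdeg' s, sum_add_distrib, hlin, sum_const, card_univ, hcI']
    simp
  have hS2 : (∑ s, G.degree s ^ 2 : ℤ) = (q ^ 2 + 1) * (q ^ 2 - #X) ^ 2 +
      2 * (q ^ 2 - #X) * (#X * (q + 1)) +
      ((∑ s : I, #{p ∈ X | polar κ p s = 0} ^ 2 : ℕ) : ℤ) := by
    zify at hlin
    have : ∀ s : I, (G.degree s : ℤ) ^ 2 = (q ^ 2 - #X) ^ 2 +
        2 * (q ^ 2 - #X) * #{p ∈ X | polar κ p s = 0} + #{p ∈ X | polar κ p s = 0} ^ 2 := by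
      intro s; rw [hdeg' s]; ring
    rw [sum_congr rfl fun s _ => this s, sum_add_distrib, sum_add_distrib, ← mul_sum, hlin,
      sum_const, card_univ, hcI']
    simp
  obtain ⟨ε, hε⟩ := Nat.exists_eq_add_of_le hle
  generalize ∑ s : I, #{p ∈ X | polar κ p s = 0} ^ 2 = M at *
  have hq' : (4 : ℤ) ≤ q := by exact_mod_cast hq
  rw [hε] at hsq hS1 hS2
  zify at hG2 hsq hG3 hε
  push_cast at hS1 hS2 hsq
  have he0 : (0 : ℤ) ≤ e := by positivity
  have hε2 : ε ≤ 2 := by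
    by_contra! h
    have h' : (3 : ℤ) ≤ ε := by exact_mod_cast h
    nlinarith [mul_le_mul_of_nonneg_right h' (by nlinarith : (0 : ℤ) ≤ q ^ 2 - q)]
  interval_cases ε
  · have he : (e : ℤ) = q ^ 2 := by push_cast at hS1; linarith
    obtain ⟨u, hu⟩ := hG3 (by rw [he]; nlinarith) (by rw [hS2, he]; push_cast at *; nlinarith)
    refine ⟨by exact_mod_cast hε, u, u.2, ?_⟩
    have h1 := hdeg u
    have : #{p ∈ X | polar κ p u = 0} = #X := by
      zify at h1; zify; linarith
    exact card_filter_eq_iff.1 this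
  · exfalso
    push_cast at *
    have he : (2 * e : ℤ) = q ^ 2 + q := by linarith
    have h4 : (4 : ℤ) * (e * (e + 1)) = (q ^ 2 + q) * (q ^ 2 + q + 2) := by
      rw [← he]; ring
    nlinarith
  · exfalso
    push_cast at *
    have he : (e : ℤ) = q := by linarith
    rw [he] at hG2
    nlinarith

variable (F) in
/-- The chosen representative vectors of a set of points of a projective space. -/
noncomputable def repFinset (A : Set (Projectivization F V)) : Finset V :=
  {v : V | ∃ P ∈ A, P.rep = v}

omit [Fintype F] in
theorem mem_repFinset {A : Set (Projectivization F V)} {v : V} :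
    v ∈ repFinset F A ↔ ∃ P ∈ A, P.rep = v := by
  simp [repFinset]

omit [Fintype F] in
theorem rep_mem_repFinset {A : Set (Projectivization F V)} {P : Projectivization F V}
    (hP : P ∈ A) : P.rep ∈ repFinset F A :=
  mem_repFinset.2 ⟨P, hP, rfl⟩

omit [Fintype F] [Fintype V] in
theorem eq_of_rep_eq_smul_rep {P Q : Projectivization F V} {a : F} (h : Q.rep = a • P.rep) :
    Q = P := by
  rw [← P.mk_rep, ← Q.mk_rep, Projectivization.mk_eq_mk_iff']
  exact ⟨a, h.symm⟩

omit [Fintype F] [Fintype V] in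
theorem exists_eq_smul_rep {v : V} (hv : v ≠ 0) :
    ∃ (P : Projectivization F V) (a : F), a ≠ 0 ∧ v = a • P.rep := by
  obtain ⟨a, ha⟩ := Projectivization.exists_smul_eq_mk_rep F v hv
  refine ⟨Projectivization.mk F v hv, (a⁻¹ : Fˣ), Units.ne_zero _, ?_⟩
  rw [← ha]
  exact (inv_smul_smul a v).symm

omit [Fintype F] in
theorem card_repFinset (A : Set (Projectivization F V)) : #(repFinset F A) = A.ncard := by
  have hinj : Function.Injective (Projectivization.rep : Projectivization F V → V) :=
    fun P Q h => eq_of_rep_eq_smul_rep (a := 1) (by rw [one_smul, h])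
  rw [← Set.ncard_image_of_injective A hinj, ← Set.ncard_coe_finset]
  congr 1
  ext v
  simp [mem_repFinset]

theorem ncard_mul {R : V → Prop} (hR : ∀ (a : F) (x : V), a ≠ 0 → R x → R (a • x)) :
    (Fintype.card F - 1) * {P : Projectivization F V | R P.rep}.ncard =
      #{x : V | R x ∧ x ≠ 0} := by
  rw [← card_reps_mul hR (I := repFinset F Set.univ), ← card_repFinset]
  · congr 2
    ext v
    simp only [mem_filter, mem_repFinset, Set.mem_univ, true_and, Set.mem_ofPred_eq]
    constructor
    · rintro ⟨P, h, rfl⟩; exact ⟨⟨P, rfl⟩, h⟩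
    · rintro ⟨⟨P, rfl⟩, h⟩; exact ⟨P, h, rfl⟩
  · intro s hs
    obtain ⟨P, -, rfl⟩ := mem_repFinset.1 hs
    exact P.rep_nonzero
  · intro x hx _
    obtain ⟨P, a, -, h⟩ := exists_eq_smul_rep (F := F) hx
    exact ⟨P.rep, rep_mem_repFinset (Set.mem_univ P), a, h⟩
  · intro s hs t ht a h
    obtain ⟨P, -, rfl⟩ := mem_repFinset.1 hs
    obtain ⟨Q, -, rfl⟩ := mem_repFinset.1 ht
    rw [eq_of_rep_eq_smul_rep h]

theorem isElliptic_of_ncard (hq : Odd q) (hq1 : 1 < q) (hF : Fintype.card F = q)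
    (hV : Fintype.card V = q ^ 4) (hnd : ∀ x : V, (∀ y, polar κ x y = 0) → x = 0)
    (h : {P : Projectivization F V | κ P.rep = 0}.ncard = q ^ 2 + 1) : IsElliptic κ q where
  one_lt := hq1
  two_ne_zero := by
    refine Ring.two_ne_zero fun h2 => ?_
    have h3 := FiniteField.even_card_iff_char_two.1 h2
    rw [hF] at h3
    have := Nat.odd_iff.1 hq
    omega
  card_field := hF
  card_space := hV
  nondegenerate := hnd
  card_isotropic := by
    have h1 := ncard_mul (F := F) (R := fun x : V => κ x = 0) (fun a x _ hx => by
      rw [QuadraticMap.map_smul, hx, smul_zero])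
    have h2 := card_isotropic_ne_zero κ
    rw [← h2, ← h1, h, hF]
    zify [hq1.le]
    ring

omit [Fintype F] in
theorem isIsotropicReps_repFinset :
    IsIsotropicReps κ (repFinset F {P : Projectivization F V | κ P.rep = 0}) where
  ne_zero := by
    intro s hs
    obtain ⟨P, -, rfl⟩ := mem_repFinset.1 hs
    exact P.rep_nonzero
  isotropic := by
    intro s hs
    obtain ⟨P, hP, rfl⟩ := mem_repFinset.1 hs
    exact hP
  exists_smul := by
    intro x hx hκ
    obtain ⟨P, a, ha, rfl⟩ := exists_eq_smul_rep (F := F) hx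
    refine ⟨P.rep, rep_mem_repFinset ?_, a, rfl⟩
    rw [QuadraticMap.map_smul] at hκ
    simpa [ha] using hκ
  eq_of_smul := by
    intro s hs t ht a h
    obtain ⟨P, -, rfl⟩ := mem_repFinset.1 hs
    obtain ⟨Q, -, rfl⟩ := mem_repFinset.1 ht
    rw [eq_of_rep_eq_smul_rep h]

theorem isIntersecting_repFinset {A : Set (Projectivization F V)} (hA : ∀ P ∈ A, κ P.rep ≠ 0)
    (h : ∀ P ∈ A, ∀ R ∈ A, ∃ S : Projectivization F V,
      κ S.rep = 0 ∧ polar κ S.rep P.rep = 0 ∧ polar κ S.rep R.rep = 0) :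
    IsIntersecting κ (repFinset F {P : Projectivization F V | κ P.rep = 0})
      (repFinset F A) where
  ne_zero := by
    intro s hs
    obtain ⟨P, hP, rfl⟩ := mem_repFinset.1 hs
    exact hA P hP
  eq_or := by
    intro s hs t ht
    obtain ⟨P, -, rfl⟩ := mem_repFinset.1 hs
    obtain ⟨Q, -, rfl⟩ := mem_repFinset.1 ht
    by_contra! hcon
    obtain ⟨hne, a, ha⟩ := hcon
    exact hne (by rw [eq_of_rep_eq_smul_rep ha])
  inter := by
    intro s hs t ht
    obtain ⟨P, hP, rfl⟩ := mem_repFinset.1 hs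
    obtain ⟨Q, hQ, rfl⟩ := mem_repFinset.1 ht
    obtain ⟨S, hS, h1, h2⟩ := h P hP Q hQ
    exact ⟨S.rep, rep_mem_repFinset hS, by rw [polar_comm, h1], by rw [polar_comm, h2]⟩

theorem IsElliptic.ncard_perp (hE : IsElliptic κ q) {S : Projectivization F V}
    (hS : κ S.rep = 0) :
    {P : Projectivization F V | κ P.rep ≠ 0 ∧ polar κ S.rep P.rep = 0}.ncard = q * (q + 1) := by
  have h1 := ncard_mul (F := F) (R := fun x : V => κ x ≠ 0 ∧ polar κ S.rep x = 0)
    (fun a x ha hx => by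
      rw [QuadraticMap.map_smul, polar_smul_right, hx.2, smul_zero]
      exact ⟨smul_ne_zero (mul_ne_zero ha ha) hx.1, rfl⟩)
  have h2 := hE.card_nonisotropic_perp_isotropic S.rep_nonzero hS
  have h3 : (q - 1) * {P : Projectivization F V | κ P.rep ≠ 0 ∧ polar κ S.rep P.rep = 0}.ncard =
      #{x : V | κ x ≠ 0 ∧ polar κ S.rep x = 0} := by
    rw [← hE.card_field, h1]
    congr 1
    ext x
    simp only [mem_filter, mem_univ, true_and, and_iff_left_iff_imp]
    rintro ⟨h, -⟩ rfl
    simp at h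
  have hq := hE.one_lt
  have hq3 : q ≤ q ^ 3 := Nat.le_self_pow (by norm_num) q
  refine Nat.eq_of_mul_eq_mul_left (by omega : 0 < q - 1) ?_
  rw [h3, h2]
  zify [hq.le, hq3]
  ring

end

/-- **Erdős–Ko–Rado for elliptic-quadric Möbius planes of odd order `q > 3`.**
An intersecting family `𝒻` of circles (= non-isotropic points of `ℙ(F⁴)`, two of them
intersecting when some isotropic point is `b`-orthogonal to both) has size at most
`q(q+1)`, with equality iff `𝒻` is the set of all circles through a fixed isotropic point. -/
theorem stmt_0 (q : ℕ) (hq : Odd q) (hq3 : 3 < q)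
    (F : Type) [Field F] [Fintype F] (hF : Fintype.card F = q)
    (κ : QuadraticForm F (Fin 4 → F))
    (hnd : ∀ x : Fin 4 → F, (∀ y : Fin 4 → F, QuadraticMap.polar (⇑κ) x y = 0) → x = 0)
    (hell : {P : Projectivization F (Fin 4 → F) | κ P.rep = 0}.ncard = q ^ 2 + 1)
    (𝒻 : Set (Projectivization F (Fin 4 → F)))
    (h𝒻 : ∀ P ∈ 𝒻, κ P.rep ≠ 0)
    (hint : ∀ P ∈ 𝒻, ∀ R ∈ 𝒻, ∃ S : Projectivization F (Fin 4 → F),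
      κ S.rep = 0 ∧ QuadraticMap.polar (⇑κ) S.rep P.rep = 0 ∧
        QuadraticMap.polar (⇑κ) S.rep R.rep = 0) :
    𝒻.ncard ≤ q * (q + 1) ∧
      (𝒻.ncard = q * (q + 1) ↔
        ∃ S : Projectivization F (Fin 4 → F), κ S.rep = 0 ∧
          𝒻 = {P : Projectivization F (Fin 4 → F) |
                κ P.rep ≠ 0 ∧ QuadraticMap.polar (⇑κ) S.rep P.rep = 0}) := by
  have hE : IsElliptic κ q :=
    isElliptic_of_ncard hq (by omega) hF (by rw [Fintype.card_fun, Fintype.card_fin, hF]) hnd hell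
  have hX := isIntersecting_repFinset h𝒻 hint
  have hcore := hX.exists_forall_polar_eq_zero isIsotropicReps_repFinset hE hq3
  rw [card_repFinset] at hcore
  refine ⟨?_, ?_, ?_⟩
  · by_contra! hlt
    exact hlt.ne' (hcore hlt.le).1
  · intro hcard
    obtain ⟨-, s, hs, h⟩ := hcore hcard.ge
    obtain ⟨S, hS, rfl⟩ := mem_repFinset.1 hs
    refine ⟨S, hS, Set.eq_of_subset_of_ncard_le (fun P hP => ⟨h𝒻 P hP, ?_⟩) ?_ (Set.toFinite _)⟩
    · rw [QuadraticMap.polar_comm]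
      exact h P.rep (rep_mem_repFinset hP)
    · rw [hE.ncard_perp hS, hcard]
  · rintro ⟨S, hS, rfl⟩
    exact hE.ncard_perp hS
end

section
/- Let q be an odd prime power and φ a field automorphism of F. Let Φ : ℙ¹ → ℙ¹ be the bijection induced by the φ-semilinear map (v₁,v₂) ↦ (φ(v₁), φ(v₂)) of F². Define Π_φ to be the set of all maps f : ℙ¹ → ℙ¹ such that either f is the map induced by an invertible 2×2 matrix M over F whose determinant is a square in F, or f = g ∘ Φ where g is the map induced by an invertible 2×2 matrix M over F whose determinant is a non-square in F (squareness of det M depends only on the induced map, since scaling M multiplies the determinant by a square). If 𝒻 ⊆ Π_φ is an intersecting family, i.e. for all f, g ∈ 𝒻 there is x ∈ ℙ¹ with f(x) = g(x), then |𝒻| ≤ q(q−1), and |𝒻| = q(q−1) if and only if there exist points P, Q ∈ ℙ¹ such that 𝒻 = { f ∈ Π_φ : f(P) = Q }. -/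
noncomputable section

/-- The map `ℙ¹ → ℙ¹` induced by an invertible 2×2 matrix `M` over `F`,
sending the class of `v` to the class of `M v`. -/
def indMap {F : Type} [Field F] (M : GL (Fin 2) F) :
    Projectivization F (Fin 2 → F) → Projectivization F (Fin 2 → F) :=
  Projectivization.map
    ((Matrix.GeneralLinearGroup.toLin M).toLinearEquiv : (Fin 2 → F) →ₗ[F] (Fin 2 → F))
    (Matrix.GeneralLinearGroup.toLin M).toLinearEquiv.injective

/-- The set `𝕄` of all maps `ℙ¹ → ℙ¹` induced by invertible 2×2 matrices over `F`,
i.e. the elements of `PGL(2,q)` acting on the projective line. -/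
def pglMaps (F : Type) [Field F] :
    Set (Projectivization F (Fin 2 → F) → Projectivization F (Fin 2 → F)) :=
  Set.range indMap

/-- The `φ`-semilinear map `(v₁, v₂) ↦ (φ v₁, φ v₂)` of `F²`. -/
def frobSemilinear {F : Type} [Field F] (φ : F ≃+* F) :
    (Fin 2 → F) →ₛₗ[(φ : F →+* F)] (Fin 2 → F) where
  toFun v := fun i => φ (v i)
  map_add' u v := by funext i; simp
  map_smul' c v := by funext i; simp [Pi.smul_apply, smul_eq_mul]

/-- The bijection `Φ : ℙ¹ → ℙ¹` induced by the `φ`-semilinear map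
`(v₁, v₂) ↦ (φ v₁, φ v₂)` of `F²`. -/
def frobMap {F : Type} [Field F] (φ : F ≃+* F) :
    Projectivization F (Fin 2 → F) → Projectivization F (Fin 2 → F) :=
  Projectivization.map (frobSemilinear φ)
    (fun u v h => by
      funext i
      exact φ.injective (congrFun h i))

section Combinatorics

open Finset

/-- A nonnegative integer matrix of order `q + 1` with all line sums equal to `q`, whose
`2 × 2` alternating sums are divisible by `q + 1`, has an entry equal to its line sum. -/
lemma exists_le_of_dvd_alternating_sum {X : Type*} [Fintype X] {q : ℕ}
    (hq : 2 ≤ q) (hX : Fintype.card X = q + 1) (T : X → X → ℤ) (hT : ∀ x y, 0 ≤ T x y)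
    (hrow : ∀ x, ∑ y, T x y = q) (hcol : ∀ y, ∑ x, T x y = q)
    (hdvd : ∀ x₁ x₂ y₁ y₂, x₁ ≠ x₂ → y₁ ≠ y₂ →
      (q + 1 : ℤ) ∣ (T x₁ y₁ - T x₂ y₁) - (T x₁ y₂ - T x₂ y₂)) :
    ∃ x y, (q : ℤ) ≤ T x y := by
  classical
  have hle : ∀ x y, T x y ≤ q := fun x y =>
    (hrow x) ▸ single_le_sum (fun y _ => hT x y) (mem_univ y)
  obtain ⟨x, x', y, hlt⟩ : ∃ x x' y, T x' y < T x y := by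
    by_contra! h
    obtain ⟨y⟩ : Nonempty X := Fintype.card_pos_iff.mp (by omega)
    have h₁ := hcol y
    rw [sum_congr rfl fun x _ => le_antisymm (h x y y) (h y x y), sum_const, card_univ, hX] at h₁
    have h₂ : (q + 1 : ℤ) ∣ q := ⟨T y y, by rw [nsmul_eq_mul] at h₁; exact_mod_cast h₁.symm⟩
    have := Int.le_of_dvd (by omega) h₂
    omega
  have hxx : x ≠ x' := by
    rintro rfl
    exact lt_irrefl _ hlt
  set c := T x y - T x' y with hc
  have hc₁ : 1 ≤ c := by omega
  have hcq : c ≤ q := by linarith [hle x y, hT x' y]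
  have hdiff : ∀ z, T x z - T x' z = c - if T x z - T x' z ≠ c then (q + 1 : ℤ) else 0 := by
    intro z
    split_ifs with hz
    · have hzy : y ≠ z := fun h => hz (h ▸ rfl)
      obtain ⟨k, hk⟩ := hdvd x x' y z hxx hzy
      have h₁ := hle x z
      have h₂ := hle x' z
      have h₃ := hT x z
      have h₄ := hT x' z
      have hk₁ : 0 < k := by
        by_contra! hk0
        rcases hk0.lt_or_eq with hk0 | hk0
        · nlinarith
        · rw [hk0, mul_zero] at hk
          exact hz (by linarith)
      have hk₂ : k < 2 := by
        by_contra! hk2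
        nlinarith
      obtain rfl : k = 1 := by omega
      linarith
    · push Not at hz
      linarith
  set K := ({z | T x z - T x' z ≠ c} : Finset X) with hK
  have hKc : (#K : ℤ) = c := by
    have h₁ : ∑ z, (T x z - T x' z) = 0 := by rw [sum_sub_distrib, hrow, hrow, sub_self]
    rw [sum_congr rfl fun z _ => hdiff z, sum_sub_distrib, sum_const, card_univ, hX, ← sum_filter,
      sum_const, ← hK] at h₁
    simp only [nsmul_eq_mul] at h₁
    push_cast at h₁
    have h₂ : (q + 1 : ℤ) * (c - #K) = 0 := by linarith
    have h₃ : (q + 1 : ℤ) ≠ 0 := by omega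
    have := (mul_eq_zero.mp h₂).resolve_left h₃
    linarith
  have hKval : ∀ z ∈ K, q + 1 - c ≤ T x' z := by
    intro z hz
    have h₁ := hdiff z
    rw [if_pos (mem_filter.mp hz).2] at h₁
    linarith [hT x z]
  have hsum : c * (q + 1 - c) ≤ q := by
    calc c * (q + 1 - c) = ∑ z ∈ K, (q + 1 - c) := by rw [sum_const, nsmul_eq_mul, hKc]
      _ ≤ ∑ z ∈ K, T x' z := sum_le_sum hKval
      _ ≤ ∑ z, T x' z := sum_le_univ_sum_of_nonneg fun z => hT x' z
      _ = q := hrow x'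
  rcases hcq.lt_or_eq with hcq | hcq
  · have hc₂ : c = 1 := by nlinarith
    obtain ⟨z, hz⟩ : K.Nonempty := card_pos.mp (by omega)
    exact ⟨x', z, by linarith [hKval z hz]⟩
  · exact ⟨x, y, by linarith [hT x' y]⟩

section SharplyThreeTransitive

variable {X : Type*} [DecidableEq X]

/-- A finite set of injective self-maps of `X` that is sharply transitive on ordered triples of
distinct points. -/
structure IsSharplyThreeTransitive (C : Finset (X → X)) : Prop where
  injective : ∀ f ∈ C, Function.Injective f
  exists_mem : ∀ x₁ x₂ x₃ y₁ y₂ y₃ : X, x₁ ≠ x₂ → x₁ ≠ x₃ → x₂ ≠ x₃ → y₁ ≠ y₂ → y₁ ≠ y₃ →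
    y₂ ≠ y₃ → ∃ f ∈ C, f x₁ = y₁ ∧ f x₂ = y₂ ∧ f x₃ = y₃
  eq_of_agree : ∀ f ∈ C, ∀ g ∈ C, ∀ x₁ x₂ x₃ : X, x₁ ≠ x₂ → x₁ ≠ x₃ → x₂ ≠ x₃ →
    f x₁ = g x₁ → f x₂ = g x₂ → f x₃ = g x₃ → f = g

/-- The number of members of `A` sending `x` to `y`. -/
def throughCount (A : Finset (X → X)) (x y : X) : ℤ := #{f ∈ A | f x = y}

lemma throughCount_nonneg (A : Finset (X → X)) (x y : X) : 0 ≤ throughCount A x y :=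
  Int.natCast_nonneg _

lemma throughCount_eq_sum (A : Finset (X → X)) (x y : X) :
    throughCount A x y = ∑ f ∈ A, if f x = y then 1 else 0 := by
  simp [throughCount]

lemma IsSharplyThreeTransitive.card_through_three {C : Finset (X → X)}
    (hC : IsSharplyThreeTransitive C) {x₁ x₂ x₃ y₁ y₂ y₃ : X}
    (hx₁₂ : x₁ ≠ x₂) (hx₁₃ : x₁ ≠ x₃) (hx₂₃ : x₂ ≠ x₃)
    (hy₁₂ : y₁ ≠ y₂) (hy₁₃ : y₁ ≠ y₃) (hy₂₃ : y₂ ≠ y₃) :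
    #{f ∈ C | (f x₁ = y₁ ∧ f x₂ = y₂) ∧ f x₃ = y₃} = 1 := by
  obtain ⟨f, hf, h₁, h₂, h₃⟩ :=
    hC.exists_mem x₁ x₂ x₃ y₁ y₂ y₃ hx₁₂ hx₁₃ hx₂₃ hy₁₂ hy₁₃ hy₂₃
  refine card_eq_one.mpr ⟨f, ?_⟩
  ext g
  simp only [mem_filter, mem_singleton]
  constructor
  · rintro ⟨hg, ⟨g₁, g₂⟩, g₃⟩
    exact hC.eq_of_agree g hg f hf x₁ x₂ x₃ hx₁₂ hx₁₃ hx₂₃ (g₁.trans h₁.symm) (g₂.trans h₂.symm)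
      (g₃.trans h₃.symm)
  · rintro rfl
    exact ⟨hf, ⟨h₁, h₂⟩, h₃⟩

variable [Fintype X]

/-- The total number of agreements of `f` with the members of `A`. -/
def agreeCount (A : Finset (X → X)) (f : X → X) : ℤ := ∑ x, throughCount A x (f x)

/-- The members of `C` tangent to `f` at `x`, together with `f` itself: those that agree with `f`
at `x`, and nowhere else unless they are equal to `f`. -/
def pencil (C : Finset (X → X)) (f : X → X) (x : X) : Finset (X → X) :=
  {g ∈ C | g x = f x ∧ ∀ z, z ≠ x → g z = f z → g = f}

/-- The number of members of `F` in the pencil of `f` at `x`. -/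
def tangentCount (C F : Finset (X → X)) (f : X → X) (x : X) : ℤ :=
  ∑ g ∈ pencil C f x, if g ∈ F then 1 else 0

/-- Up to scaling and a constant, the component of the indicator function of `F` orthogonal to the
functions `f ↦ w x (f x)`. -/
def deviation (q : ℕ) (F : Finset (X → X)) (f : X → X) : ℤ :=
  (q ^ 2 - 1) * (if f ∈ F then 1 else 0) - agreeCount F f + #F

lemma sum_throughCount_right (A : Finset (X → X)) (x : X) :
    ∑ y, throughCount A x y = #A := by
  simp_rw [throughCount_eq_sum]
  rw [sum_comm]
  simp

lemma sum_throughCount_left {A : Finset (X → X)} (hA : ∀ f ∈ A, Function.Injective f) (y : X) :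
    ∑ x, throughCount A x y = #A := by
  simp_rw [throughCount_eq_sum]
  rw [sum_comm, card_eq_sum_ones]
  push_cast
  refine sum_congr rfl fun f hf => ?_
  obtain ⟨x, rfl⟩ := (Finite.injective_iff_surjective.mp (hA f hf)) y
  simp [(hA f hf).eq_iff]

lemma sum_agreeCount (A B : Finset (X → X)) :
    ∑ f ∈ B, agreeCount A f = ∑ x, ∑ y, throughCount B x y * throughCount A x y := by
  simp_rw [agreeCount]
  rw [sum_comm]
  refine sum_congr rfl fun x _ => ?_
  simp_rw [throughCount_eq_sum B, sum_mul]
  rw [sum_comm]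
  simp

lemma agreeCount_eq_sum (A : Finset (X → X)) (f : X → X) :
    agreeCount A f = ∑ g ∈ A, (#{x | g x = f x} : ℤ) := by
  simp_rw [agreeCount, throughCount_eq_sum]
  rw [sum_comm]
  simp

namespace IsSharplyThreeTransitive

variable {C : Finset (X → X)} {q : ℕ}

lemma card_through_two (hC : IsSharplyThreeTransitive C) (hq : 2 ≤ q)
    (hX : Fintype.card X = q + 1) {x₁ x₂ y₁ y₂ : X} (hx : x₁ ≠ x₂) (hy : y₁ ≠ y₂) :
    (#{f ∈ C | f x₁ = y₁ ∧ f x₂ = y₂} : ℤ) = q - 1 := by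
  obtain ⟨x₃, hx₃⟩ : ∃ x₃, x₃ ∉ ({x₁, x₂} : Finset X) := by
    by_contra! h
    have := card_le_card (s := univ) (t := {x₁, x₂}) fun x _ => h x
    rw [card_univ, card_pair hx] at this
    omega
  simp only [mem_insert, mem_singleton, not_or] at hx₃
  rw [← sum_throughCount_right _ x₃]
  have key : ∀ y, throughCount {f ∈ C | f x₁ = y₁ ∧ f x₂ = y₂} x₃ y =
      if y ∈ ({y₁, y₂} : Finset X)ᶜ then 1 else 0 := by
    intro y
    rw [throughCount, filter_filter]
    split_ifs with h
    · simp only [mem_compl, mem_insert, mem_singleton, not_or] at h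
      rw [hC.card_through_three hx (Ne.symm hx₃.1) (Ne.symm hx₃.2) hy (Ne.symm h.1)
        (Ne.symm h.2), Nat.cast_one]
    · rw [Nat.cast_eq_zero, card_eq_zero, filter_eq_empty_iff]
      rintro f hf ⟨⟨rfl, rfl⟩, rfl⟩
      simp [(hC.injective f hf).eq_iff, hx₃] at h
  simp only [key, sum_boole, filter_univ_mem, card_compl, hX, card_pair hy]
  omega

lemma throughCount_through (hC : IsSharplyThreeTransitive C) (hq : 2 ≤ q)
    (hX : Fintype.card X = q + 1) {x y z w : X} (hx : z ≠ x) :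
    throughCount {f ∈ C | f x = y} z w = if w = y then 0 else (q - 1 : ℤ) := by
  rw [throughCount, filter_filter]
  split_ifs with h
  · rw [Nat.cast_eq_zero, card_eq_zero, filter_eq_empty_iff]
    rintro f hf ⟨rfl, h'⟩
    exact hx (hC.injective f hf (h'.trans h))
  · exact hC.card_through_two hq hX hx.symm (Ne.symm h)

lemma throughCount_eq (hC : IsSharplyThreeTransitive C) (hq : 2 ≤ q)
    (hX : Fintype.card X = q + 1) (x y : X) : throughCount C x y = q * (q - 1) := by
  have : Nontrivial X := Fintype.one_lt_card_iff_nontrivial.mp (by omega)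
  obtain ⟨z, hz⟩ := exists_ne x
  rw [throughCount, ← sum_throughCount_right _ z]
  simp only [hC.throughCount_through hq hX hz]
  rw [sum_ite, sum_const_zero, sum_const, filter_ne', card_erase_of_mem (mem_univ y), card_univ, hX]
  simp

lemma card_eq (hC : IsSharplyThreeTransitive C) (hq : 2 ≤ q)
    (hX : Fintype.card X = q + 1) : (#C : ℤ) = (q + 1) * (q * (q - 1)) := by
  obtain ⟨x⟩ : Nonempty X := Fintype.card_pos_iff.mp (by omega)
  rw [← sum_throughCount_right _ x]
  simp [hC.throughCount_eq hq hX, hX]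

lemma mem_pencil_self {f : X → X} (hf : f ∈ C) (x : X) : f ∈ pencil C f x := by
  simp [pencil, hf]

lemma mem_pencil_comm {f g : X → X} {x : X} (hf : f ∈ C) (hg : g ∈ C) :
    g ∈ pencil C f x ↔ f ∈ pencil C g x := by
  simp only [pencil, mem_filter, hf, hg, true_and]
  constructor <;> exact fun ⟨h₁, h₂⟩ => ⟨h₁.symm, fun z hz h => (h₂ z hz h.symm).symm⟩

lemma sum_pencil_comm (u v : (X → X) → ℤ) (x : X) :
    ∑ f ∈ C, ∑ g ∈ pencil C f x, u f * v g = ∑ g ∈ C, ∑ f ∈ pencil C g x, u f * v g := by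
  refine sum_comm' fun f g => ?_
  constructor
  · rintro ⟨hf, hg⟩
    have hg' : g ∈ C := (mem_filter.mp hg).1
    exact ⟨(mem_pencil_comm hf hg').mp hg, hg'⟩
  · rintro ⟨hf, hg⟩
    have hf' : f ∈ C := (mem_filter.mp hf).1
    exact ⟨hf', (mem_pencil_comm hf' hg).mpr hf⟩

lemma throughCount_pencil (hC : IsSharplyThreeTransitive C) (hq : 2 ≤ q)
    (hX : Fintype.card X = q + 1) {f : X → X} (hf : f ∈ C) {x z w : X} (hz : z ≠ x)
    (hw : w ≠ f x) : throughCount (pencil C f x) z w = 1 := by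
  rw [throughCount, Nat.cast_eq_one]
  by_cases hfw : f z = w
  · refine card_eq_one.mpr ⟨f, ?_⟩
    ext g
    simp only [pencil, mem_filter, mem_singleton]
    constructor
    · rintro ⟨⟨-, -, h⟩, h'⟩
      exact h z hz (h'.trans hfw.symm)
    · rintro rfl
      exact ⟨⟨hf, rfl, fun _ _ _ => rfl⟩, hfw⟩
  obtain ⟨p, rfl⟩ := (Finite.injective_iff_surjective.mp (hC.injective f hf)) w
  have hpx : p ≠ x := fun h => hw (h ▸ rfl)
  have hpz : p ≠ z := fun h => hfw (h ▸ rfl)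
  have inj := hC.injective f hf
  set B := ({g ∈ C | g x = f x ∧ g z = f p} : Finset (X → X)) with hB
  set U := ({x, z, p} : Finset X)ᶜ with hU
  have cardB : (#B : ℤ) = q - 1 := hC.card_through_two hq hX hz.symm hw.symm
  have cardU : #U + 2 = q := by
    have : #({x, z, p} : Finset X) = 3 :=
      card_eq_three.mpr ⟨x, z, p, hz.symm, hpx.symm, hpz.symm, rfl⟩
    rw [hU, card_compl, hX, this]
    have := card_le_univ ({x, z, p} : Finset X)
    omega
  have hsplit := card_filter_add_card_filter_not (s := B) (fun g => ∃ t, t ≠ x ∧ g t = f t)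
  have hsecond : #{g ∈ B | ∃ t, t ≠ x ∧ g t = f t} = #U := by
    have h₁ : ∀ t ∈ U, #{g ∈ B | g t = f t} = 1 := by
      intro t ht
      simp only [hU, mem_compl, mem_insert, mem_singleton, not_or] at ht
      rw [hB, filter_filter]
      exact hC.card_through_three hz.symm (Ne.symm ht.1) (Ne.symm ht.2.1) hw.symm
        (inj.ne (Ne.symm ht.1)) (inj.ne (Ne.symm ht.2.2))
    have h₂ : ∀ g ∈ B, #{t ∈ U | g t = f t} = if (∃ t, t ≠ x ∧ g t = f t) then 1 else 0 := by
      intro g hg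
      simp only [hB, mem_filter] at hg
      obtain ⟨hgC, hgx, hgz⟩ := hg
      split_ifs with h
      · obtain ⟨t, htx, ht⟩ := h
        have htz : t ≠ z := by
          rintro rfl
          exact hpz (inj (hgz.symm.trans ht))
        have htp : t ≠ p := by
          rintro rfl
          exact hpz (hC.injective g hgC (ht.trans hgz.symm))
        refine card_eq_one.mpr ⟨t, ?_⟩
        ext s
        simp only [hU, mem_filter, mem_compl, mem_insert, mem_singleton, not_or]
        constructor
        · rintro ⟨⟨hsx, -, -⟩, hs⟩
          by_contra hst
          have := hC.eq_of_agree g hgC f hf x s t (Ne.symm hsx) (Ne.symm htx) hst hgx hs ht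
          subst this
          exact hpz (inj hgz.symm)
        · rintro rfl
          exact ⟨⟨htx, htz, htp⟩, ht⟩
      · rw [card_eq_zero, filter_eq_empty_iff]
        intro t ht
        simp only [hU, mem_compl, mem_insert, mem_singleton, not_or] at ht
        exact fun hgt => h ⟨t, ht.1, hgt⟩
    have := sum_card_bipartiteAbove_eq_sum_card_bipartiteBelow (s := U) (t := B)
      (fun t g => g t = f t)
    simp only [bipartiteAbove, bipartiteBelow] at this
    rw [sum_congr rfl h₁, sum_congr rfl h₂] at this
    rw [card_filter, ← this, card_eq_sum_ones]
  have hfirst : ({g ∈ pencil C f x | g z = f p} : Finset (X → X)) =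
      {g ∈ B | ¬ ∃ t, t ≠ x ∧ g t = f t} := by
    ext g
    simp only [pencil, hB, mem_filter]
    constructor
    · rintro ⟨⟨hg, hgx, h⟩, hgz⟩
      refine ⟨⟨hg, hgx, hgz⟩, ?_⟩
      rintro ⟨t, ht, hgt⟩
      rw [h t ht hgt] at hgz
      exact hfw hgz
    · rintro ⟨⟨hg, hgx, hgz⟩, h⟩
      exact ⟨⟨hg, hgx, fun t ht hgt => absurd ⟨t, ht, hgt⟩ h⟩, hgz⟩
  rw [hfirst]
  omega

lemma throughCount_pencil_base {f : X → X} (x y : X) :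
    throughCount (pencil C f x) x y = if y = f x then (#(pencil C f x) : ℤ) else 0 := by
  have h : ∀ g ∈ pencil C f x, g x = f x := fun g hg => (mem_filter.mp hg).2.1
  rw [throughCount]
  split_ifs with hy
  · rw [filter_true_of_mem fun g hg => (h g hg).trans hy.symm]
  · rw [filter_false_of_mem fun g hg hgy => hy (hgy.symm.trans (h g hg)), card_empty, Nat.cast_zero]

lemma throughCount_pencil_eq_zero (hC : IsSharplyThreeTransitive C) {f : X → X} {x z : X}
    (hz : z ≠ x) : throughCount (pencil C f x) z (f x) = 0 := by
  rw [throughCount, filter_false_of_mem, card_empty, Nat.cast_zero]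
  intro g hg hgz
  obtain ⟨hgC, hgx, -⟩ := mem_filter.mp hg
  exact hz (hC.injective g hgC (hgz.trans hgx.symm))

lemma card_pencil (hC : IsSharplyThreeTransitive C) (hq : 2 ≤ q)
    (hX : Fintype.card X = q + 1) {f : X → X} (hf : f ∈ C) (x : X) :
    (#(pencil C f x) : ℤ) = q := by
  have : Nontrivial X := Fintype.one_lt_card_iff_nontrivial.mp (by omega)
  obtain ⟨z, hz⟩ := exists_ne x
  have key : ∀ w, throughCount (pencil C f x) z w = if w = f x then 0 else 1 := by
    intro w
    split_ifs with h
    · rw [h, hC.throughCount_pencil_eq_zero hz]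
    · exact hC.throughCount_pencil hq hX hf hz h
  rw [← sum_throughCount_right _ z, sum_congr rfl fun w _ => key w, sum_ite, sum_const_zero,
    sum_const, filter_ne', card_erase_of_mem (mem_univ _), card_univ, hX]
  simp

/-- Agreement sums over a family whose members are equidistributed over the pairs `(z, w)` with
`z ≠ x` and `w ≠ y`. -/
lemma sum_agreeCount_of_equidistributed {A F : Finset (X → X)} (hX : Fintype.card X = q + 1)
    (hF : ∀ f ∈ F, Function.Injective f) {x y : X} {a b : ℤ}
    (h : ∀ z w, throughCount A z w =
      if z = x then (if w = y then a else 0) else (if w = y then 0 else b)) :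
    ∑ f ∈ A, agreeCount F f =
      a * throughCount F x y + b * ((q - 1) * #F + throughCount F x y) := by
  have h' : ∀ z w, throughCount A z w * throughCount F z w =
      (if z = x then (if w = y then (a + b) * throughCount F z w else 0) else 0) +
      b * throughCount F z w - (if z = x then b * throughCount F z w else 0) -
      (if w = y then b * throughCount F z w else 0) := by
    intro z w
    rw [h]
    split_ifs <;> ring
  rw [sum_agreeCount]
  simp only [h', sum_add_distrib, sum_sub_distrib]
  have e₁ : ∑ z, ∑ w, b * throughCount F z w = b * ((q + 1) * #F) := by
    simp [← mul_sum, sum_throughCount_right, hX, mul_left_comm]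
  have e₂ : ∑ z, ∑ w, (if z = x then b * throughCount F z w else 0) = b * #F := by
    rw [sum_comm]
    simp [← mul_sum, sum_throughCount_right]
  have e₃ : ∑ z, ∑ w, (if w = y then b * throughCount F z w else 0) = b * #F := by
    simp [← mul_sum, sum_throughCount_left hF]
  have e₄ : ∑ z, ∑ w, (if z = x then (if w = y then (a + b) * throughCount F z w else 0) else 0)
      = (a + b) * throughCount F x y := by
    rw [sum_comm]
    simp
  rw [e₁, e₂, e₃, e₄]
  ring

lemma sum_agreeCount_through (hC : IsSharplyThreeTransitive C) (hq : 2 ≤ q)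
    (hX : Fintype.card X = q + 1) {F : Finset (X → X)} (hF : F ⊆ C) (x y : X) :
    ∑ f ∈ C with f x = y, agreeCount F f =
      (q ^ 2 - 1) * throughCount F x y + (q - 1) ^ 2 * #F := by
  rw [sum_agreeCount_of_equidistributed (a := q * (q - 1)) (b := q - 1) (x := x) (y := y) hX
    fun f hf => hC.injective f (hF hf)]
  · ring
  intro z w
  split_ifs with hz hw hw
  · rw [hz, hw, throughCount, filter_filter]
    simpa only [and_self, throughCount] using hC.throughCount_eq hq hX x y
  · rw [hz, throughCount, filter_filter, filter_false_of_mem, card_empty, Nat.cast_zero]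
    rintro f - ⟨rfl, h⟩
    exact hw h.symm
  · rw [hC.throughCount_through hq hX hz, if_pos hw]
  · rw [hC.throughCount_through hq hX hz, if_neg hw]

lemma sum_agreeCount_pencil (hC : IsSharplyThreeTransitive C) (hq : 2 ≤ q)
    (hX : Fintype.card X = q + 1) {F : Finset (X → X)} (hF : F ⊆ C) {f : X → X} (hf : f ∈ C)
    (x : X) :
    ∑ g ∈ pencil C f x, agreeCount F g =
      (q + 1) * throughCount F x (f x) + (q - 1) * #F := by
  rw [sum_agreeCount_of_equidistributed (a := q) (b := 1) (x := x) (y := f x) hX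
    fun f hf => hC.injective f (hF hf)]
  · ring
  intro z w
  split_ifs with hz hw hw
  · rw [hz, throughCount_pencil_base, if_pos hw, hC.card_pencil hq hX hf]
  · rw [hz, throughCount_pencil_base, if_neg hw]
  · rw [hw, hC.throughCount_pencil_eq_zero hz]
  · exact hC.throughCount_pencil hq hX hf hz hw

lemma sum_agreeCount_through_two (hC : IsSharplyThreeTransitive C) (hq : 2 ≤ q)
    (hX : Fintype.card X = q + 1) {F : Finset (X → X)} (hF : F ⊆ C) {x₁ x₂ y₁ y₂ : X}
    (hx : x₁ ≠ x₂) (hy : y₁ ≠ y₂) :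
    ∑ f ∈ C with f x₁ = y₁ ∧ f x₂ = y₂, agreeCount F f =
      q * (throughCount F x₁ y₁ + throughCount F x₂ y₂) + throughCount F x₁ y₂ +
        throughCount F x₂ y₁ + (q - 3) * #F := by
  have hcount : ∀ z w, throughCount {f ∈ C | f x₁ = y₁ ∧ f x₂ = y₂} z w =
      if z = x₁ then (if w = y₁ then (q - 1 : ℤ) else 0) else
        if z = x₂ then (if w = y₂ then (q - 1 : ℤ) else 0) else
          if w = y₁ then 0 else if w = y₂ then 0 else 1 := by
    intro z w
    rw [throughCount, filter_filter]
    split_ifs with h₁ h₂ h₁ h₂ h₃ h₄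
    · subst h₁ h₂
      rw [← hC.card_through_two hq hX hx hy]
      congr 2
      exact filter_congr fun f _ => by tauto
    · rw [filter_false_of_mem, card_empty, Nat.cast_zero]
      rintro f - ⟨⟨rfl, rfl⟩, rfl⟩
      exact h₂ (h₁ ▸ rfl)
    · subst h₁ h₂
      rw [← hC.card_through_two hq hX hx hy]
      congr 2
      exact filter_congr fun f _ => by tauto
    · rw [filter_false_of_mem, card_empty, Nat.cast_zero]
      rintro f - ⟨⟨rfl, rfl⟩, rfl⟩
      exact h₂ (h₁ ▸ rfl)
    · rw [filter_false_of_mem, card_empty, Nat.cast_zero]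
      rintro f hf ⟨⟨rfl, rfl⟩, rfl⟩
      simp_all [(hC.injective f hf).eq_iff]
    · rw [filter_false_of_mem, card_empty, Nat.cast_zero]
      rintro f hf ⟨⟨rfl, rfl⟩, rfl⟩
      simp_all [(hC.injective f hf).eq_iff]
    · rw [hC.card_through_three hx (Ne.symm ‹_›) (Ne.symm ‹_›) hy (Ne.symm ‹_›) (Ne.symm ‹_›),
        Nat.cast_one]
  have h' : ∀ z w, throughCount {f ∈ C | f x₁ = y₁ ∧ f x₂ = y₂} z w * throughCount F z w =
      (if z = x₁ then (if w = y₁ then q * throughCount F z w else 0) else 0) +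
      (if z = x₂ then (if w = y₂ then q * throughCount F z w else 0) else 0) +
      (if z = x₁ then (if w = y₂ then throughCount F z w else 0) else 0) +
      (if z = x₂ then (if w = y₁ then throughCount F z w else 0) else 0) +
      throughCount F z w - (if z = x₁ then throughCount F z w else 0) -
      (if z = x₂ then throughCount F z w else 0) -
      (if w = y₁ then throughCount F z w else 0) - (if w = y₂ then throughCount F z w else 0) := by
    intro z w
    rw [hcount]
    by_cases h₁ : z = x₁ <;> by_cases h₂ : z = x₂ <;> by_cases h₃ : w = y₁ <;>
      by_cases h₄ : w = y₂ <;> simp_all <;> ring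
  rw [sum_agreeCount]
  simp only [h', sum_add_distrib, sum_sub_distrib]
  have e₁ : ∑ z, ∑ w, throughCount F z w = (q + 1) * #F := by
    simp [sum_throughCount_right, hX]
  have e₂ : ∀ x, ∑ z, ∑ w, (if z = x then throughCount F z w else 0) = #F := by
    intro x
    rw [sum_comm]
    simp [sum_throughCount_right]
  have e₃ : ∀ y, ∑ z, ∑ w, (if w = y then throughCount F z w else 0) = #F := by
    intro y
    simp [sum_throughCount_left fun f hf => hC.injective f (hF hf)]
  have e₄ : ∀ x y, ∀ c : ℤ,
      ∑ z, ∑ w, (if z = x then (if w = y then c * throughCount F z w else 0) else 0)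
        = c * throughCount F x y := by
    intro x y c
    rw [sum_comm]
    simp
  have e₅ : ∀ x y,
      ∑ z, ∑ w, (if z = x then (if w = y then throughCount F z w else 0) else 0)
        = throughCount F x y := by
    intro x y
    rw [sum_comm]
    simp
  simp only [e₁, e₂, e₃, e₄, e₅]
  ring

lemma card_pencil_add_card_agree (hC : IsSharplyThreeTransitive C) {f g : X → X} (hf : f ∈ C)
    (hg : g ∈ C) (hne : g ≠ f) (h : ∃ x, g x = f x) :
    #{x | g ∈ pencil C f x} + #{x | g x = f x} = 2 := by
  obtain ⟨x, hx⟩ := h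
  by_cases h' : ∃ z, z ≠ x ∧ g z = f z
  · obtain ⟨z, hzx, hz⟩ := h'
    have h₁ : ({t | g ∈ pencil C f t} : Finset X) = ∅ := by
      refine filter_false_of_mem fun t _ ht => hne ?_
      obtain ⟨-, -, ht⟩ := mem_filter.mp ht
      by_cases htx : t = x
      · exact ht z (htx ▸ hzx) hz
      · exact ht x (Ne.symm htx) hx
    have h₂ : ({t | g t = f t} : Finset X) = {x, z} := by
      ext t
      simp only [mem_filter, mem_univ, true_and, mem_insert, mem_singleton]
      constructor
      · intro ht
        by_contra! h
        exact hne (hC.eq_of_agree g hg f hf x z t hzx.symm h.1.symm h.2.symm hx hz ht)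
      · rintro (rfl | rfl) <;> assumption
    rw [h₁, h₂, card_empty, card_pair hzx.symm]
  · push Not at h'
    have h₂ : ({t | g t = f t} : Finset X) = {x} := by
      ext t
      simp only [mem_filter, mem_univ, true_and, mem_singleton]
      constructor
      · intro ht
        by_contra htx
        exact h' t htx ht
      · rintro rfl
        exact hx
    have h₁ : ({t | g ∈ pencil C f t} : Finset X) = {x} := by
      ext t
      simp only [pencil, mem_filter, mem_univ, true_and, mem_singleton]
      constructor
      · rintro ⟨-, ht, -⟩
        by_contra htx
        exact h' t htx ht
      · rintro rfl
        exact ⟨hg, hx, fun z hz hgz => absurd hgz (h' z hz)⟩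
    rw [h₁, h₂, card_singleton]

section Family

variable {F : Finset (X → X)}

lemma tangentCount_eq (f : X → X) (x : X) :
    tangentCount C F f x = ∑ g ∈ F, if g ∈ pencil C f x then 1 else 0 := by
  rw [tangentCount, sum_boole, sum_boole]
  congr 2
  ext g
  simp only [mem_filter, pencil]
  constructor
  · rintro ⟨h₁, h₂⟩
    exact ⟨h₂, h₁⟩
  · rintro ⟨h₁, h₂⟩
    exact ⟨h₂, h₁⟩

lemma sum_tangentCount_add_agreeCount (hC : IsSharplyThreeTransitive C)
    (hX : Fintype.card X = q + 1) (hF : F ⊆ C) (hint : ∀ f ∈ F, ∀ g ∈ F, ∃ x, f x = g x)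
    {f : X → X} (hf : f ∈ F) :
    ∑ x, tangentCount C F f x + agreeCount F f = 2 * q + 2 * #F := by
  rw [agreeCount_eq_sum]
  simp only [tangentCount_eq]
  rw [sum_comm, ← sum_add_distrib]
  have key : ∀ g ∈ F, (∑ x, if g ∈ pencil C f x then 1 else 0) + (#{x | g x = f x} : ℤ) =
      2 + if g = f then 2 * (q : ℤ) else 0 := by
    intro g hg
    split_ifs with hgf
    · subst hgf
      simp [mem_pencil_self (hF hg), hX]
      ring
    · have := hC.card_pencil_add_card_agree (hF hf) (hF hg) hgf (hint g hg f hf)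
      rw [sum_boole]
      exact_mod_cast this
  rw [sum_congr rfl key, sum_add_distrib]
  simp [hf]
  ring

lemma sum_agreeCount_self : ∑ f ∈ F, agreeCount F f = ∑ x, ∑ y, throughCount F x y ^ 2 := by
  simp only [sum_agreeCount, pow_two]

lemma sum_agreeCount_all (hC : IsSharplyThreeTransitive C) (hq : 2 ≤ q)
    (hX : Fintype.card X = q + 1) :
    ∑ f ∈ C, agreeCount F f = q * (q ^ 2 - 1) * #F := by
  simp only [sum_agreeCount, hC.throughCount_eq hq hX, ← mul_sum, sum_throughCount_right]
  simp [hX]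
  ring

lemma sum_agreeCount_sq (hC : IsSharplyThreeTransitive C) (hq : 2 ≤ q)
    (hX : Fintype.card X = q + 1) (hF : F ⊆ C) :
    ∑ f ∈ C, agreeCount F f ^ 2 =
      (q ^ 2 - 1) * ∑ f ∈ F, agreeCount F f + (q - 1) * (q ^ 2 - 1) * #F ^ 2 := by
  have h : ∀ f ∈ C, agreeCount F f ^ 2 =
      ∑ x, ∑ y, throughCount F x y * (if f x = y then agreeCount F f else 0) := by
    intro f _
    rw [pow_two]
    nth_rw 1 [agreeCount]
    simp [sum_mul]
  rw [sum_congr rfl h, sum_comm]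
  have h₂ : ∀ x, ∑ f ∈ C, ∑ y, throughCount F x y * (if f x = y then agreeCount F f else 0) =
      ∑ y, ((q ^ 2 - 1) * throughCount F x y ^ 2 + (q - 1) ^ 2 * #F * throughCount F x y) := by
    intro x
    rw [sum_comm]
    refine sum_congr rfl fun y _ => ?_
    rw [← mul_sum, ← sum_filter, hC.sum_agreeCount_through hq hX hF]
    ring
  simp only [h₂, sum_add_distrib, ← mul_sum, sum_throughCount_right, sum_agreeCount_self]
  simp [hX]
  ring

lemma sum_indicator (hF : F ⊆ C) (u : (X → X) → ℤ) :
    ∑ f ∈ C, (if f ∈ F then 1 else 0) * u f = ∑ f ∈ F, u f := by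
  simp [inter_eq_right.mpr hF]

lemma sum_deviation (hC : IsSharplyThreeTransitive C) (hq : 2 ≤ q)
    (hX : Fintype.card X = q + 1) (hF : F ⊆ C) :
    ∑ f ∈ C, deviation q F f = (q ^ 2 - 1) * #F := by
  simp only [deviation, sum_add_distrib, sum_sub_distrib, ← mul_sum, hC.sum_agreeCount_all hq hX]
  have := sum_indicator hF fun _ => 1
  simp only [mul_one] at this
  rw [this]
  simp [hC.card_eq hq hX]
  ring

lemma sum_deviation_family :
    ∑ f ∈ F, deviation q F f =
      (q ^ 2 - 1) * #F - ∑ f ∈ F, agreeCount F f + (#F : ℤ) ^ 2 := by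
  have : ∀ f ∈ F, deviation q F f = (q ^ 2 - 1) - agreeCount F f + #F := by
    intro f hf
    simp [deviation, hf]
  rw [sum_congr rfl this]
  simp [sum_add_distrib, sum_sub_distrib]
  ring

lemma sum_deviation_mul_agreeCount (hC : IsSharplyThreeTransitive C) (hq : 2 ≤ q)
    (hX : Fintype.card X = q + 1) (hF : F ⊆ C) :
    ∑ f ∈ C, deviation q F f * agreeCount F f = (q ^ 2 - 1) * (#F : ℤ) ^ 2 := by
  have : ∀ f ∈ C, deviation q F f * agreeCount F f =
      (q ^ 2 - 1) * ((if f ∈ F then 1 else 0) * agreeCount F f) - agreeCount F f ^ 2 +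
        #F * agreeCount F f := by
    intro f _
    rw [deviation]
    ring
  rw [sum_congr rfl this, sum_add_distrib, sum_sub_distrib, ← mul_sum, ← mul_sum,
    sum_indicator hF, hC.sum_agreeCount_sq hq hX hF, hC.sum_agreeCount_all hq hX]
  ring

lemma sum_deviation_sq (hC : IsSharplyThreeTransitive C) (hq : 2 ≤ q)
    (hX : Fintype.card X = q + 1) (hF : F ⊆ C) :
    ∑ f ∈ C, deviation q F f ^ 2 =
      (q ^ 2 - 1) * ((q ^ 2 - 1) * #F - ∑ f ∈ F, agreeCount F f + (#F : ℤ) ^ 2) := by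
  have : ∀ f ∈ C, deviation q F f ^ 2 =
      (q ^ 2 - 1) * ((if f ∈ F then 1 else 0) * deviation q F f) -
        deviation q F f * agreeCount F f + #F * deviation q F f := by
    intro f _
    simp only [deviation]
    ring
  rw [sum_congr rfl this, sum_add_distrib, sum_sub_distrib, ← mul_sum, ← mul_sum,
    sum_indicator hF, hC.sum_deviation_mul_agreeCount hq hX hF, sum_deviation_family,
    hC.sum_deviation hq hX hF]
  ring

lemma sum_deviation_pencil (hC : IsSharplyThreeTransitive C) (hq : 2 ≤ q)
    (hX : Fintype.card X = q + 1) (hF : F ⊆ C) {f : X → X} (hf : f ∈ C) (x : X) :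
    ∑ g ∈ pencil C f x, deviation q F g =
      (q ^ 2 - 1) * tangentCount C F f x - (q + 1) * throughCount F x (f x) + #F := by
  simp only [deviation, sum_add_distrib, sum_sub_distrib, ← mul_sum]
  rw [hC.sum_agreeCount_pencil hq hX hF hf, ← tangentCount, sum_const, nsmul_eq_mul,
    hC.card_pencil hq hX hf]
  ring

/-- The Dirichlet form of `deviation q F` on the tangency graph. -/
lemma sum_sq_deviation_sub (hC : IsSharplyThreeTransitive C) (hq : 2 ≤ q)
    (hX : Fintype.card X = q + 1) (hF : F ⊆ C) (hint : ∀ f ∈ F, ∀ g ∈ F, ∃ x, f x = g x) :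
    ∑ x, ∑ f ∈ C, ∑ g ∈ pencil C f x, (deviation q F f - deviation q F g) ^ 2 =
      2 * (q ^ 2 - 1) ^ 2 * (#F * (q * (q - 1) - #F)) := by
  have hsum : ∀ f ∈ C, ∑ x, ∑ g ∈ pencil C f x, deviation q F g =
      (q ^ 2 - 1) * ∑ x, tangentCount C F f x - (q + 1) * agreeCount F f + (q + 1) * #F := by
    intro f hf
    simp only [hC.sum_deviation_pencil hq hX hF hf, sum_add_distrib, sum_sub_distrib, ← mul_sum,
      agreeCount]
    simp [hX]
  have hfamily : ∑ f ∈ F, ∑ x, ∑ g ∈ pencil C f x, deviation q F g =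
      (q ^ 2 - 1) * (#F * (2 * q + 2 * #F) - ∑ f ∈ F, agreeCount F f) -
        (q + 1) * ∑ f ∈ F, agreeCount F f + (q + 1) * (#F : ℤ) ^ 2 := by
    have : ∀ f ∈ F, ∑ x, ∑ g ∈ pencil C f x, deviation q F g =
        (q ^ 2 - 1) * ((2 * q + 2 * #F) - agreeCount F f) - (q + 1) * agreeCount F f +
          (q + 1) * #F := by
      intro f hf
      rw [hsum f (hF hf), ← hC.sum_tangentCount_add_agreeCount hX hF hint hf]
      ring
    rw [sum_congr rfl this]
    simp only [sum_add_distrib, sum_sub_distrib, ← mul_sum, sum_const, nsmul_eq_mul]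
    ring
  have htangent : ∑ f ∈ C, deviation q F f * ∑ x, tangentCount C F f x =
      ∑ f ∈ F, ∑ x, ∑ g ∈ pencil C f x, deviation q F g := by
    calc ∑ f ∈ C, deviation q F f * ∑ x, tangentCount C F f x
        = ∑ x, ∑ f ∈ C, ∑ g ∈ pencil C f x, deviation q F f * (if g ∈ F then 1 else 0) := by
          simp only [tangentCount, mul_sum]
          rw [sum_comm]
      _ = ∑ x, ∑ f ∈ F, ∑ g ∈ pencil C f x, deviation q F g := by
          refine sum_congr rfl fun x _ => ?_
          rw [sum_pencil_comm, ← sum_indicator hF]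
          refine sum_congr rfl fun f _ => ?_
          rw [← sum_mul, mul_comm]
      _ = _ := sum_comm
  have hcross : ∑ f ∈ C, deviation q F f * ∑ x, ∑ g ∈ pencil C f x, deviation q F g =
      (q ^ 2 - 1) * ((q ^ 2 - 1) * (#F * (2 * q + 2 * #F) - ∑ f ∈ F, agreeCount F f) -
        (q + 1) * ∑ f ∈ F, agreeCount F f + (q + 1) * (#F : ℤ) ^ 2) := by
    have : ∀ f ∈ C, deviation q F f * ∑ x, ∑ g ∈ pencil C f x, deviation q F g =
        (q ^ 2 - 1) * (deviation q F f * ∑ x, tangentCount C F f x) -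
          (q + 1) * (deviation q F f * agreeCount F f) + (q + 1) * #F * deviation q F f := by
      intro f hf
      rw [hsum f hf]
      ring
    rw [sum_congr rfl this, sum_add_distrib, sum_sub_distrib, ← mul_sum, ← mul_sum, ← mul_sum,
      htangent, hfamily, hC.sum_deviation_mul_agreeCount hq hX hF, hC.sum_deviation hq hX hF]
    ring
  have hsq₁ : ∀ x, ∑ f ∈ C, ∑ _g ∈ pencil C f x, deviation q F f ^ 2 =
      q * ∑ f ∈ C, deviation q F f ^ 2 := by
    intro x
    rw [mul_sum]
    refine sum_congr rfl fun f hf => ?_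
    rw [sum_const, nsmul_eq_mul, hC.card_pencil hq hX hf]
  have hsq₂ : ∀ x, ∑ f ∈ C, ∑ g ∈ pencil C f x, deviation q F g ^ 2 =
      q * ∑ f ∈ C, deviation q F f ^ 2 := by
    intro x
    rw [← hsq₁ x]
    simpa using sum_pencil_comm (C := C) (fun _ => 1) (fun g => deviation q F g ^ 2) x
  have hexp : ∀ x, ∑ f ∈ C, ∑ g ∈ pencil C f x, (deviation q F f - deviation q F g) ^ 2 =
      2 * q * ∑ f ∈ C, deviation q F f ^ 2 -
        2 * ∑ f ∈ C, deviation q F f * ∑ g ∈ pencil C f x, deviation q F g := by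
    intro x
    have : ∀ f ∈ C, ∑ g ∈ pencil C f x, (deviation q F f - deviation q F g) ^ 2 =
        ∑ _g ∈ pencil C f x, deviation q F f ^ 2 + ∑ g ∈ pencil C f x, deviation q F g ^ 2 -
          2 * (deviation q F f * ∑ g ∈ pencil C f x, deviation q F g) := by
      intro f _
      rw [mul_sum, mul_sum, ← sum_add_distrib, ← sum_sub_distrib]
      exact sum_congr rfl fun g _ => by ring
    rw [sum_congr rfl this, sum_sub_distrib, sum_add_distrib, hsq₁, hsq₂, ← mul_sum]
    ring
  have hcomm : ∑ x, ∑ f ∈ C, deviation q F f * ∑ g ∈ pencil C f x, deviation q F g =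
      ∑ f ∈ C, deviation q F f * ∑ x, ∑ g ∈ pencil C f x, deviation q F g := by
    rw [sum_comm]
    simp only [← mul_sum]
  simp only [hexp, sum_sub_distrib]
  rw [← mul_sum, ← mul_sum, hcomm, hcross, sum_const, card_univ, hX, hC.sum_deviation_sq hq hX hF]
  simp only [nsmul_eq_mul]
  push_cast
  ring

/-- An intersecting family in a sharply 3-transitive set of degree `q + 1` has at most `q (q - 1)`
members. -/
theorem card_le_of_intersecting (hC : IsSharplyThreeTransitive C) (hq : 2 ≤ q)
    (hX : Fintype.card X = q + 1) (hF : F ⊆ C) (hint : ∀ f ∈ F, ∀ g ∈ F, ∃ x, f x = g x) :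
    (#F : ℤ) ≤ q * (q - 1) := by
  have h := hC.sum_sq_deviation_sub hq hX hF hint
  have hnonneg : 0 ≤ ∑ x, ∑ f ∈ C, ∑ g ∈ pencil C f x,
      (deviation q F f - deviation q F g) ^ 2 :=
    sum_nonneg fun _ _ => sum_nonneg fun _ _ => sum_nonneg fun _ _ => sq_nonneg _
  rw [h] at hnonneg
  have hq' : (2 : ℤ) ≤ q := by exact_mod_cast hq
  have hk : (0 : ℤ) < 2 * (q ^ 2 - 1) ^ 2 := by
    have : (0 : ℤ) < q ^ 2 - 1 := by nlinarith
    positivity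
  have hpos := nonneg_of_mul_nonneg_right hnonneg hk
  by_contra! hlt
  have : (0 : ℤ) ≤ q * (q - 1) := by nlinarith
  nlinarith

lemma exists_mem_pencil_apply_eq (hC : IsSharplyThreeTransitive C) (hq : 2 ≤ q)
    (hX : Fintype.card X = q + 1) {f : X → X} (hf : f ∈ C) (x y : X) :
    ∃ z, ∃ g ∈ pencil C f z, g x = y := by
  by_cases hfx : f x = y
  · exact ⟨x, f, mem_pencil_self hf x, hfx⟩
  obtain ⟨p, rfl⟩ := (Finite.injective_iff_surjective.mp (hC.injective f hf)) y
  obtain ⟨z, hz⟩ : ∃ z, z ∉ ({x, p} : Finset X) := by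
    by_contra! h
    have h₁ := card_le_card (s := univ) (t := {x, p}) fun x _ => h x
    have h₂ := card_le_two (a := x) (b := p)
    rw [card_univ] at h₁
    omega
  simp only [mem_insert, mem_singleton, not_or] at hz
  have h := hC.throughCount_pencil hq hX hf (Ne.symm hz.1)
    ((hC.injective f hf).ne (Ne.symm hz.2))
  rw [throughCount, Nat.cast_eq_one] at h
  obtain ⟨g, hg⟩ := card_pos.mp (h ▸ one_pos)
  exact ⟨z, g, (mem_filter.mp hg).1, (mem_filter.mp hg).2⟩

lemma deviation_eq_of_mem_pencil (hC : IsSharplyThreeTransitive C) (hq : 2 ≤ q)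
    (hX : Fintype.card X = q + 1) (hF : F ⊆ C) (hint : ∀ f ∈ F, ∀ g ∈ F, ∃ x, f x = g x)
    (hcard : (#F : ℤ) = q * (q - 1)) {f g : X → X} {x : X} (hf : f ∈ C)
    (hg : g ∈ pencil C f x) : deviation q F g = deviation q F f := by
  have h := hC.sum_sq_deviation_sub hq hX hF hint
  rw [hcard, sub_self, mul_zero, mul_zero, sum_eq_zero_iff_of_nonneg
    fun _ _ => sum_nonneg fun _ _ => sum_nonneg fun _ _ => sq_nonneg _] at h
  have h := h x (mem_univ x)
  rw [sum_eq_zero_iff_of_nonneg fun _ _ => sum_nonneg fun _ _ => sq_nonneg _] at h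
  have h := h f hf
  rw [sum_eq_zero_iff_of_nonneg fun _ _ => sq_nonneg _] at h
  have h := h g hg
  linarith [pow_eq_zero_iff two_ne_zero |>.mp h]

lemma mul_deviation_eq (hC : IsSharplyThreeTransitive C) (hq : 2 ≤ q)
    (hX : Fintype.card X = q + 1) (hF : F ⊆ C) (hint : ∀ f ∈ F, ∀ g ∈ F, ∃ x, f x = g x)
    (hcard : (#F : ℤ) = q * (q - 1)) {f : X → X} (hf : f ∈ C) (x : X) :
    q * (deviation q F f - (q - 1)) =
      (q + 1) * ((q - 1) * tangentCount C F f x - throughCount F x (f x)) := by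
  have h := hC.sum_deviation_pencil hq hX hF hf x
  rw [sum_congr rfl fun g hg => hC.deviation_eq_of_mem_pencil hq hX hF hint hcard hf hg,
    sum_const, nsmul_eq_mul, hC.card_pencil hq hX hf, hcard] at h
  linear_combination h

lemma le_deviation (hC : IsSharplyThreeTransitive C) (hq : 2 ≤ q)
    (hX : Fintype.card X = q + 1) (hF : F ⊆ C) (hint : ∀ f ∈ F, ∀ g ∈ F, ∃ x, f x = g x)
    (hcard : (#F : ℤ) = q * (q - 1)) {f : X → X} (hf : f ∈ C) :
    (q - 1 : ℤ) ≤ deviation q F f := by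
  by_contra! hlt
  obtain ⟨x⟩ : Nonempty X := Fintype.card_pos_iff.mp (by omega)
  have hcop : IsCoprime (q + 1 : ℤ) q := ⟨1, -1, by ring⟩
  obtain ⟨m, hm⟩ : (q + 1 : ℤ) ∣ deviation q F f - (q - 1) :=
    hcop.dvd_of_dvd_mul_left ⟨_, hC.mul_deviation_eq hq hX hF hint hcard hf x⟩
  have hm0 : m ≤ -1 := by
    by_contra! hm0
    nlinarith
  have hlarge : ∀ y, (q : ℤ) ≤ throughCount F x y := by
    intro y
    obtain ⟨z, g, hg, rfl⟩ := hC.exists_mem_pencil_apply_eq hq hX hf x y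
    have h := hC.mul_deviation_eq hq hX hF hint hcard (mem_filter.mp hg).1 x
    rw [hC.deviation_eq_of_mem_pencil hq hX hF hint hcard hf hg, hm, mul_left_comm] at h
    have h := mul_left_cancel₀ (by omega : (q + 1 : ℤ) ≠ 0) h
    have h0 : 0 ≤ tangentCount C F g x := by
      rw [tangentCount, sum_boole]
      exact Int.natCast_nonneg _
    have h1 : 0 ≤ (q - 1 : ℤ) * tangentCount C F g x := mul_nonneg (by omega) h0
    nlinarith
  have h := sum_le_sum fun y (_ : y ∈ univ) => hlarge y
  rw [sum_throughCount_right, hcard, sum_const, card_univ, hX, nsmul_eq_mul] at h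
  push_cast at h
  nlinarith

lemma deviation_eq (hC : IsSharplyThreeTransitive C) (hq : 2 ≤ q)
    (hX : Fintype.card X = q + 1) (hF : F ⊆ C) (hint : ∀ f ∈ F, ∀ g ∈ F, ∃ x, f x = g x)
    (hcard : (#F : ℤ) = q * (q - 1)) {f : X → X} (hf : f ∈ C) :
    deviation q F f = q - 1 := by
  have h : ∑ f ∈ C, (deviation q F f - (q - 1)) = 0 := by
    rw [sum_sub_distrib, hC.sum_deviation hq hX hF, sum_const, nsmul_eq_mul, hC.card_eq hq hX,
      hcard]
    ring
  rw [sum_eq_zero_iff_of_nonneg fun f hf =>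
    sub_nonneg.mpr (hC.le_deviation hq hX hF hint hcard hf)] at h
  exact sub_eq_zero.mp (h f hf)

/-- An intersecting family of maximum size in a sharply 3-transitive set consists of all members
sending a fixed point to a fixed point. -/
theorem exists_eq_filter_of_card_eq (hC : IsSharplyThreeTransitive C) (hq : 2 ≤ q)
    (hX : Fintype.card X = q + 1) (hF : F ⊆ C) (hint : ∀ f ∈ F, ∀ g ∈ F, ∃ x, f x = g x)
    (hcard : (#F : ℤ) = q * (q - 1)) : ∃ P Q, F = {f ∈ C | f P = Q} := by
  have hq1 : (0 : ℤ) < q - 1 := by omega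
  have hdvd : ∀ x y, (q - 1 : ℤ) ∣ throughCount F x y := by
    intro x y
    have hpos : 0 < #{f ∈ C | f x = y} := by
      have := hC.throughCount_eq hq hX x y
      rw [throughCount] at this
      have : (0 : ℤ) < #{f ∈ C | f x = y} := by
        rw [this]
        exact mul_pos (by omega) hq1
      exact_mod_cast this
    obtain ⟨f, hf⟩ := card_pos.mp hpos
    obtain ⟨hfC, rfl⟩ := mem_filter.mp hf
    have h := hC.mul_deviation_eq hq hX hF hint hcard hfC x
    rw [hC.deviation_eq hq hX hF hint hcard hfC, sub_self, mul_zero, eq_comm] at h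
    have h := (mul_eq_zero.mp h).resolve_left (by omega)
    exact ⟨_, (sub_eq_zero.mp h).symm⟩
  choose T hT using hdvd
  have hline : ∀ t : X → ℤ, ∑ y, (q - 1) * t y = #F → ∑ y, t y = q := by
    intro t ht
    rw [← mul_sum, hcard, mul_comm (q : ℤ)] at ht
    exact mul_left_cancel₀ hq1.ne' ht
  obtain ⟨P, Q, hPQ⟩ : ∃ x y, (q : ℤ) ≤ T x y := by
    refine exists_le_of_dvd_alternating_sum hq hX T (fun x y => ?_) (fun x => ?_) (fun y => ?_) ?_
    · have := throughCount_nonneg F x y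
      rw [hT] at this
      exact nonneg_of_mul_nonneg_right this hq1
    · refine hline _ ?_
      rw [← sum_throughCount_right F x]
      exact sum_congr rfl fun y _ => (hT x y).symm
    · refine hline (fun x => T x y) ?_
      rw [← sum_throughCount_left (fun f hf => hC.injective f (hF hf)) y]
      exact sum_congr rfl fun x _ => (hT x y).symm
    · intro x₁ x₂ y₁ y₂ hx hy
      have h₁ := hC.sum_agreeCount_through_two hq hX hF hx hy
      have h₂ : ∀ f ∈ ({f ∈ C | f x₁ = y₁ ∧ f x₂ = y₂} : Finset (X → X)), agreeCount F f =
          (q ^ 2 - 1) * (if f ∈ F then 1 else 0) + (q - 1) ^ 2 := by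
        intro f hf
        have h := hC.deviation_eq hq hX hF hint hcard (mem_filter.mp hf).1
        rw [deviation, hcard] at h
        linear_combination -h
      rw [sum_congr rfl h₂, sum_add_distrib, ← mul_sum, sum_const, nsmul_eq_mul,
        hC.card_through_two hq hX hx hy, hT, hT, hT, hT, hcard] at h₁
      set l : ℤ := ∑ f ∈ C with f x₁ = y₁ ∧ f x₂ = y₂, if f ∈ F then 1 else 0
      refine ⟨T x₁ y₁ + T x₂ y₂ - 1 - l, mul_left_cancel₀ hq1.ne' ?_⟩
      linear_combination h₁
  refine ⟨P, Q, ?_⟩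
  have h₁ : ({f ∈ F | f P = Q} : Finset (X → X)) = F := by
    refine eq_of_subset_of_card_le (filter_subset _ _) ?_
    have : (#F : ℤ) ≤ throughCount F P Q := by
      rw [hcard, hT]
      nlinarith
    rw [throughCount] at this
    exact_mod_cast this
  refine eq_of_subset_of_card_le (fun f hf => ?_) ?_
  · rw [← h₁] at hf
    exact mem_filter.mpr ⟨hF (mem_filter.mp hf).1, (mem_filter.mp hf).2⟩
  · have : throughCount C P Q ≤ #F := by rw [hC.throughCount_eq hq hX, hcard]
    rw [throughCount] at this
    exact_mod_cast this

end Family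
end IsSharplyThreeTransitive
end SharplyThreeTransitive
end Combinatorics

section ProjectiveLine

variable {F : Type} [Field F]

lemma indMap_mk (M : GL (Fin 2) F) (v : Fin 2 → F) (hv : v ≠ 0)
    (hMv : (M : Matrix (Fin 2) (Fin 2) F).mulVec v ≠ 0) :
    indMap M (Projectivization.mk F v hv) =
      Projectivization.mk F ((M : Matrix (Fin 2) (Fin 2) F).mulVec v) hMv :=
  rfl

lemma mulVec_ne_zero_of_ne_zero (M : GL (Fin 2) F) {v : Fin 2 → F} (hv : v ≠ 0) :
    (M : Matrix (Fin 2) (Fin 2) F).mulVec v ≠ 0 := by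
  rw [← Matrix.mulVec_zero (M : Matrix (Fin 2) (Fin 2) F)]
  exact (Matrix.mulVec_injective_of_isUnit M.isUnit).ne hv

lemma indMap_mul (M N : GL (Fin 2) F) : indMap (M * N) = indMap M ∘ indMap N := by
  funext x
  induction x using Projectivization.ind with | h v hv =>
  rw [Function.comp_apply, indMap_mk _ _ _ (mulVec_ne_zero_of_ne_zero _ hv),
    indMap_mk _ _ _ (mulVec_ne_zero_of_ne_zero _ hv),
    indMap_mk _ _ _ (mulVec_ne_zero_of_ne_zero _ (mulVec_ne_zero_of_ne_zero _ hv))]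
  simp only [Units.val_mul, Matrix.mulVec_mulVec]

lemma indMap_one : indMap (1 : GL (Fin 2) F) = id := by
  funext x
  induction x using Projectivization.ind with | h v hv =>
  rw [indMap_mk _ _ _ (mulVec_ne_zero_of_ne_zero _ hv)]
  simp

lemma indMap_inv_apply (M : GL (Fin 2) F) (x : Projectivization F (Fin 2 → F)) :
    indMap M⁻¹ (indMap M x) = x := by
  rw [← Function.comp_apply (f := indMap M⁻¹), ← indMap_mul, inv_mul_cancel, indMap_one, id]

lemma indMap_surjective (M : GL (Fin 2) F) : Function.Surjective (indMap M) := fun x =>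
  ⟨indMap M⁻¹ x, by simpa using indMap_inv_apply M⁻¹ x⟩

lemma frobMap_mk (φ : F ≃+* F) (v : Fin 2 → F) (hv : v ≠ 0) (hv' : (fun i => φ (v i)) ≠ 0) :
    frobMap φ (Projectivization.mk F v hv) = Projectivization.mk F (fun i => φ (v i)) hv' :=
  rfl

lemma frob_ne_zero (φ : F ≃+* F) {v : Fin 2 → F} (hv : v ≠ 0) : (fun i => φ (v i)) ≠ 0 := by
  contrapose! hv
  funext i
  simpa using congrFun hv i

lemma frobMap_refl : frobMap (RingEquiv.refl F) = id := by
  funext x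
  induction x using Projectivization.ind with | h v hv => rfl

lemma frobMap_injective (φ : F ≃+* F) : Function.Injective (frobMap φ) := by
  have h : ∀ x, frobMap φ.symm (frobMap φ x) = x := by
    intro x
    induction x using Projectivization.ind with | h v hv =>
    rw [frobMap_mk _ _ _ (frob_ne_zero φ hv),
      frobMap_mk _ _ _ (frob_ne_zero _ (frob_ne_zero φ hv))]
    simp
  exact Function.LeftInverse.injective h

lemma frobMap_comp_indMap (φ : F ≃+* F) (M : GL (Fin 2) F) :
    frobMap φ ∘ indMap M =
      indMap (Matrix.GeneralLinearGroup.map (φ : F →+* F) M) ∘ frobMap φ := by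
  funext x
  induction x using Projectivization.ind with | h v hv =>
  rw [Function.comp_apply, Function.comp_apply,
    indMap_mk _ _ _ (mulVec_ne_zero_of_ne_zero _ hv),
    frobMap_mk _ _ _ (frob_ne_zero φ (mulVec_ne_zero_of_ne_zero _ hv)),
    frobMap_mk _ _ _ (frob_ne_zero φ hv),
    indMap_mk _ _ _ (mulVec_ne_zero_of_ne_zero _ (frob_ne_zero φ hv))]
  congr 1
  funext i
  simp [Matrix.mulVec, dotProduct, Fin.sum_univ_two]

/-- The standard projective frame `[1 : 0], [0 : 1], [1 : 1]`. -/
def stdFrame (F : Type) [Field F] : Fin 3 → Projectivization F (Fin 2 → F) :=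
  ![.mk F ![1, 0] (by simp), .mk F ![0, 1] (by simp), .mk F ![1, 1] (by simp)]

lemma frobMap_stdFrame (φ : F ≃+* F) (i : Fin 3) : frobMap φ (stdFrame F i) = stdFrame F i := by
  fin_cases i
  all_goals
    refine (frobMap_mk φ _ _ (frob_ne_zero φ (by simp))).trans ?_
    simp only [stdFrame]
    congr 1
    funext i
    fin_cases i <;> simp

lemma cross_ne_zero_of_mk_ne {u v : Fin 2 → F} {hu : u ≠ 0} {hv : v ≠ 0}
    (h : Projectivization.mk F u hu ≠ Projectivization.mk F v hv) :
    u 0 * v 1 - u 1 * v 0 ≠ 0 := by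
  contrapose! h
  rw [Projectivization.mk_eq_mk_iff']
  by_cases h0 : v 0 = 0
  · have h1 : v 1 ≠ 0 := by
      intro h1
      apply hv
      funext i
      fin_cases i <;> assumption
    refine ⟨u 1 / v 1, ?_⟩
    funext i
    fin_cases i
    · simp only [h0, mul_zero, sub_zero, mul_eq_zero, h1, or_false] at h
      simp [h0, h]
    · simp [h1]
  · refine ⟨u 0 / v 0, ?_⟩
    funext i
    fin_cases i
    · simp [h0]
    · simp only [Fin.mk_one, Pi.smul_apply, smul_eq_mul]
      field_simp
      linear_combination h

lemma exists_indMap_stdFrame {x : Fin 3 → Projectivization F (Fin 2 → F)}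
    (h₁₂ : x 0 ≠ x 1) (h₁₃ : x 0 ≠ x 2) (h₂₃ : x 1 ≠ x 2) :
    ∃ M : GL (Fin 2) F, ∀ i, indMap M (stdFrame F i) = x i := by
  obtain ⟨u, hu, hxu⟩ : ∃ u hu, Projectivization.mk F u hu = x 0 :=
    ⟨_, _, (x 0).mk_rep⟩
  obtain ⟨v, hv, hxv⟩ : ∃ u hu, Projectivization.mk F u hu = x 1 :=
    ⟨_, _, (x 1).mk_rep⟩
  obtain ⟨w, hw, hxw⟩ : ∃ u hu, Projectivization.mk F u hu = x 2 :=
    ⟨_, _, (x 2).mk_rep⟩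
  rw [← hxu, ← hxv] at h₁₂
  rw [← hxu, ← hxw] at h₁₃
  rw [← hxv, ← hxw] at h₂₃
  have d₁₂ := cross_ne_zero_of_mk_ne h₁₂
  have d₁₃ := cross_ne_zero_of_mk_ne h₁₃
  have d₂₃ := cross_ne_zero_of_mk_ne h₂₃
  set D := u 0 * v 1 - u 1 * v 0
  set a := (v 0 * w 1 - v 1 * w 0)
  set b := (u 0 * w 1 - u 1 * w 0)
  have hdet : Matrix.det !![-a * u 0, b * v 0; -a * u 1, b * v 1] ≠ 0 := by
    rw [Matrix.det_fin_two_of]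
    have : -a * u 0 * (b * v 1) - b * v 0 * (-a * u 1) = -(a * b * D) := by ring
    rw [this]
    exact neg_ne_zero.mpr (mul_ne_zero (mul_ne_zero d₂₃ d₁₃) d₁₂)
  refine ⟨.mkOfDetNeZero _ hdet, fun i => ?_⟩
  fin_cases i
  · refine ((indMap_mk _ _ _ (mulVec_ne_zero_of_ne_zero _ (by simp))).trans ?_).trans hxu
    rw [Projectivization.mk_eq_mk_iff']
    refine ⟨-a, ?_⟩
    funext i
    fin_cases i <;> simp [Matrix.GeneralLinearGroup.mkOfDetNeZero, Matrix.mulVec, dotProduct]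
  · refine ((indMap_mk _ _ _ (mulVec_ne_zero_of_ne_zero _ (by simp))).trans ?_).trans hxv
    rw [Projectivization.mk_eq_mk_iff']
    refine ⟨b, ?_⟩
    funext i
    fin_cases i <;> simp [Matrix.GeneralLinearGroup.mkOfDetNeZero, Matrix.mulVec, dotProduct]
  · refine ((indMap_mk _ _ _ (mulVec_ne_zero_of_ne_zero _ (by simp))).trans ?_).trans hxw
    rw [Projectivization.mk_eq_mk_iff']
    refine ⟨D, ?_⟩
    funext i
    fin_cases i <;>
      simp [Matrix.GeneralLinearGroup.mkOfDetNeZero, Matrix.mulVec, dotProduct, D, a, b] <;> ring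

lemma indMap_eq_id_and_isSquare_det {M : GL (Fin 2) F}
    (h : ∀ i, indMap M (stdFrame F i) = stdFrame F i) :
    indMap M = id ∧ IsSquare (M : Matrix (Fin 2) (Fin 2) F).det := by
  have h₀ := (indMap_mk M ![1, 0] (by simp) (mulVec_ne_zero_of_ne_zero _ (by simp))).symm.trans (h 0)
  have h₁ := (indMap_mk M ![0, 1] (by simp) (mulVec_ne_zero_of_ne_zero _ (by simp))).symm.trans (h 1)
  have h₂ := (indMap_mk M ![1, 1] (by simp) (mulVec_ne_zero_of_ne_zero _ (by simp))).symm.trans (h 2)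
  obtain ⟨a, ha⟩ := (Projectivization.mk_eq_mk_iff' _ _ _ _ _).mp h₀
  obtain ⟨b, hb⟩ := (Projectivization.mk_eq_mk_iff' _ _ _ _ _).mp h₁
  obtain ⟨c, hc⟩ := (Projectivization.mk_eq_mk_iff' _ _ _ _ _).mp h₂
  have m₁₀ : M 1 0 = 0 := by
    simpa [Matrix.mulVec, dotProduct, eq_comm] using congrFun ha 1
  have m₀₁ : M 0 1 = 0 := by
    simpa [Matrix.mulVec, dotProduct, eq_comm] using congrFun hb 0
  have m₀₀ : M 0 0 = c := by
    simpa [Matrix.mulVec, dotProduct, m₀₁, eq_comm] using congrFun hc 0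
  have m₁₁ : M 1 1 = c := by
    simpa [Matrix.mulVec, dotProduct, m₁₀, eq_comm] using congrFun hc 1
  constructor
  · funext x
    induction x using Projectivization.ind with | h v hv =>
    rw [indMap_mk _ _ _ (mulVec_ne_zero_of_ne_zero _ hv), id, Projectivization.mk_eq_mk_iff']
    refine ⟨c, ?_⟩
    funext i
    fin_cases i <;> simp [Matrix.mulVec, dotProduct, m₀₀, m₀₁, m₁₀, m₁₁]
  · exact ⟨c, by rw [Matrix.det_fin_two, m₀₀, m₀₁, m₁₁]; ring⟩

lemma indMap_eq_and_isSquare_det_mul {M N : GL (Fin 2) F}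
    (h : ∀ i, indMap M (stdFrame F i) = indMap N (stdFrame F i)) :
    indMap M = indMap N ∧
      IsSquare ((M : Matrix (Fin 2) (Fin 2) F).det * (N : Matrix (Fin 2) (Fin 2) F).det) := by
  have h' : ∀ i, indMap (N⁻¹ * M) (stdFrame F i) = stdFrame F i := by
    intro i
    rw [indMap_mul, Function.comp_apply, h, indMap_inv_apply]
  obtain ⟨hid, c, hc⟩ := indMap_eq_id_and_isSquare_det h'
  have hM : M = N * (N⁻¹ * M) := by group
  refine ⟨?_, ?_⟩
  · rw [hM, indMap_mul, hid, Function.comp_id]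
  · refine ⟨(N : Matrix (Fin 2) (Fin 2) F).det * c, ?_⟩
    conv_lhs => rw [hM]
    rw [Units.val_mul N, Matrix.det_mul, hc]
    ring

lemma isSquare_mul_iff [Fintype F] {a b : F} (ha : a ≠ 0) (hb : b ≠ 0) :
    IsSquare (a * b) ↔ (IsSquare a ↔ IsSquare b) := by
  classical
  rw [← quadraticChar_one_iff_isSquare ha, ← quadraticChar_one_iff_isSquare hb,
    ← quadraticChar_one_iff_isSquare (mul_ne_zero ha hb), map_mul]
  rcases quadraticChar_dichotomy ha with h | h <;> rcases quadraticChar_dichotomy hb with h' | h' <;>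
    rw [h, h'] <;> decide

lemma isSquare_det_map_iff (φ : F ≃+* F) (M : GL (Fin 2) F) :
    IsSquare (Matrix.GeneralLinearGroup.map (φ : F →+* F) M : Matrix (Fin 2) (Fin 2) F).det ↔
      IsSquare (M : Matrix (Fin 2) (Fin 2) F).det := by
  have : (Matrix.GeneralLinearGroup.map (φ : F →+* F) M : Matrix (Fin 2) (Fin 2) F).det =
      φ (M : Matrix (Fin 2) (Fin 2) F).det := by
    simp [Matrix.det_fin_two]
  rw [this]
  exact ⟨fun h => by simpa using h.map φ.symm, fun h => h.map φ⟩

open Classical in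
/-- The field automorphism with which a matrix is composed in the set `Π_φ`: the identity if the
determinant is a square, and `φ` otherwise. -/
def twist (φ : F ≃+* F) (M : GL (Fin 2) F) : F ≃+* F :=
  if IsSquare (M : Matrix (Fin 2) (Fin 2) F).det then RingEquiv.refl F else φ

/-- The set `Π_φ`, described uniformly. -/
def twistedMaps (φ : F ≃+* F) :
    Set (Projectivization F (Fin 2 → F) → Projectivization F (Fin 2 → F)) :=
  Set.range fun M => indMap M ∘ frobMap (twist φ M)

lemma twistedMaps_eq (φ : F ≃+* F) :
    twistedMaps φ = {f | (∃ M : GL (Fin 2) F,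
          IsSquare ((M : Matrix (Fin 2) (Fin 2) F).det) ∧ f = indMap M) ∨
        (∃ M : GL (Fin 2) F,
          ¬ IsSquare ((M : Matrix (Fin 2) (Fin 2) F).det) ∧ f = indMap M ∘ frobMap φ)} := by
  ext f
  constructor
  · rintro ⟨M, rfl⟩
    by_cases hM : IsSquare (M : Matrix (Fin 2) (Fin 2) F).det
    · exact .inl ⟨M, hM, by simp [twist, hM, frobMap_refl]⟩
    · exact .inr ⟨M, hM, by simp [twist, hM]⟩
  · rintro (⟨M, hM, rfl⟩ | ⟨M, hM, rfl⟩)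
    · exact ⟨M, by simp [twist, hM, frobMap_refl]⟩
    · exact ⟨M, by simp [twist, hM]⟩

lemma twistedMap_indMap_stdFrame (φ : F ≃+* F) (M h : GL (Fin 2) F) (i : Fin 3) :
    (indMap M ∘ frobMap φ) (indMap h (stdFrame F i)) =
      indMap (M * Matrix.GeneralLinearGroup.map (φ : F →+* F) h) (stdFrame F i) := by
  have := congrFun (frobMap_comp_indMap φ h) (stdFrame F i)
  rw [Function.comp_apply, Function.comp_apply, frobMap_stdFrame] at this
  rw [indMap_mul, Function.comp_apply, Function.comp_apply, this]

lemma isSquare_det_mul_map_iff [Fintype F] (φ : F ≃+* F) (M h : GL (Fin 2) F) :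
    IsSquare (M * Matrix.GeneralLinearGroup.map (φ : F →+* F) h :
        GL (Fin 2) F).1.det ↔
      (IsSquare (M : Matrix (Fin 2) (Fin 2) F).det ↔
        IsSquare (h : Matrix (Fin 2) (Fin 2) F).det) := by
  rw [Units.val_mul, Matrix.det_mul, isSquare_mul_iff (Matrix.GeneralLinearGroup.det_ne_zero M)
    (Matrix.GeneralLinearGroup.det_ne_zero _), isSquare_det_map_iff]

lemma isSharplyThreeTransitive_toFinset [Fintype F]
    [Fintype (Projectivization F (Fin 2 → F))] [DecidableEq (Projectivization F (Fin 2 → F))]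
    (φ : F ≃+* F) [Fintype (twistedMaps φ)] :
    IsSharplyThreeTransitive (twistedMaps φ).toFinset where
  injective f hf := by
    obtain ⟨M, rfl⟩ := Set.mem_toFinset.mp hf
    exact (Function.LeftInverse.injective (indMap_inv_apply M)).comp (frobMap_injective _)
  exists_mem x₁ x₂ x₃ y₁ y₂ y₃ hx₁₂ hx₁₃ hx₂₃ hy₁₂ hy₁₃ hy₂₃ := by
    obtain ⟨h, hh⟩ := exists_indMap_stdFrame (x := ![x₁, x₂, x₃]) hx₁₂ hx₁₃ hx₂₃
    obtain ⟨k, hk⟩ := exists_indMap_stdFrame (x := ![y₁, y₂, y₃]) hy₁₂ hy₁₃ hy₂₃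
    obtain ⟨M, hM⟩ : ∃ M, M * Matrix.GeneralLinearGroup.map (twist φ M : F →+* F) h = k := by
      by_cases hsq : IsSquare (h : Matrix (Fin 2) (Fin 2) F).det ↔
          IsSquare (k : Matrix (Fin 2) (Fin 2) F).det
      · set M := k * (Matrix.GeneralLinearGroup.map (RingEquiv.refl F : F →+* F) h)⁻¹ with hM
        have hMk : M * Matrix.GeneralLinearGroup.map (RingEquiv.refl F : F →+* F) h = k := by
          rw [hM]; group
        have hdet := isSquare_det_mul_map_iff (RingEquiv.refl F) M h
        rw [hMk] at hdet
        have htw : twist φ M = RingEquiv.refl F := if_pos (by tauto)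
        exact ⟨M, by rw [htw, hMk]⟩
      · set M := k * (Matrix.GeneralLinearGroup.map (φ : F →+* F) h)⁻¹ with hM
        have hMk : M * Matrix.GeneralLinearGroup.map (φ : F →+* F) h = k := by
          rw [hM]; group
        have hdet := isSquare_det_mul_map_iff φ M h
        rw [hMk] at hdet
        have htw : twist φ M = φ := if_neg (by tauto)
        exact ⟨M, by rw [htw, hMk]⟩
    have key : ∀ i, (indMap M ∘ frobMap (twist φ M)) (![x₁, x₂, x₃] i) = ![y₁, y₂, y₃] i := by
      intro i
      rw [← hh, ← hk, twistedMap_indMap_stdFrame, hM]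
    exact ⟨_, Set.mem_toFinset.mpr ⟨M, rfl⟩, key 0, key 1, key 2⟩
  eq_of_agree f hf g hg x₁ x₂ x₃ hx₁₂ hx₁₃ hx₂₃ h₁ h₂ h₃ := by
    obtain ⟨M, rfl⟩ := Set.mem_toFinset.mp hf
    obtain ⟨N, rfl⟩ := Set.mem_toFinset.mp hg
    obtain ⟨h, hh⟩ := exists_indMap_stdFrame (x := ![x₁, x₂, x₃]) hx₁₂ hx₁₃ hx₂₃
    have hagree : ∀ i,
        indMap (M * Matrix.GeneralLinearGroup.map (twist φ M : F →+* F) h) (stdFrame F i) =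
        indMap (N * Matrix.GeneralLinearGroup.map (twist φ N : F →+* F) h) (stdFrame F i) := by
      intro i
      rw [← twistedMap_indMap_stdFrame, ← twistedMap_indMap_stdFrame, hh]
      fin_cases i
      exacts [h₁, h₂, h₃]
    obtain ⟨heq, hsq⟩ := indMap_eq_and_isSquare_det_mul hagree
    rw [isSquare_mul_iff (Matrix.GeneralLinearGroup.det_ne_zero _)
      (Matrix.GeneralLinearGroup.det_ne_zero _), isSquare_det_mul_map_iff,
      isSquare_det_mul_map_iff] at hsq
    have htw : twist φ M = twist φ N := by
      have : IsSquare (M : Matrix (Fin 2) (Fin 2) F).det ↔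
          IsSquare (N : Matrix (Fin 2) (Fin 2) F).det := by tauto
      by_cases hM : IsSquare (M : Matrix (Fin 2) (Fin 2) F).det
      · rw [twist, twist, if_pos hM, if_pos (this.mp hM)]
      · rw [twist, twist, if_neg hM, if_neg (mt this.mpr hM)]
    rw [htw, indMap_mul, indMap_mul] at heq
    change indMap M ∘ frobMap (twist φ M) = indMap N ∘ frobMap (twist φ N)
    rw [htw]
    refine (indMap_surjective h).injective_comp_right ?_
    change indMap M ∘ frobMap _ ∘ indMap h = indMap N ∘ frobMap _ ∘ indMap h
    rw [frobMap_comp_indMap, ← Function.comp_assoc, heq, Function.comp_assoc]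

end ProjectiveLine

/-- **Erdős–Ko–Rado for the Minkowski planes `CM(2,q,φ)`.** An intersecting family in the
sharply 3-transitive set `Π_φ` has size at most `q(q−1)`, with equality iff it is the set
of all elements of `Π_φ` mapping some fixed point `P` to some fixed point `Q`. -/
theorem stmt_1 (q : ℕ) (hq : Odd q) (hqp : IsPrimePow q)
    (F : Type) [Field F] [Fintype F] (hF : Fintype.card F = q)
    (φ : F ≃+* F)
    (Pi_φ : Set (Projectivization F (Fin 2 → F) → Projectivization F (Fin 2 → F)))
    (hPi : Pi_φ = {f | (∃ M : GL (Fin 2) F,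
          IsSquare ((M : Matrix (Fin 2) (Fin 2) F).det) ∧ f = indMap M) ∨
        (∃ M : GL (Fin 2) F,
          ¬ IsSquare ((M : Matrix (Fin 2) (Fin 2) F).det) ∧ f = indMap M ∘ frobMap φ)})
    (𝒻 : Set (Projectivization F (Fin 2 → F) → Projectivization F (Fin 2 → F)))
    (h𝒻 : 𝒻 ⊆ Pi_φ)
    (hint : ∀ f ∈ 𝒻, ∀ g ∈ 𝒻, ∃ x, f x = g x) :
    𝒻.ncard ≤ q * (q - 1) ∧
      (𝒻.ncard = q * (q - 1) ↔
        ∃ P Q : Projectivization F (Fin 2 → F), 𝒻 = {f ∈ Pi_φ | f P = Q}) := by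
  classical
  have : Fintype (Projectivization F (Fin 2 → F)) := Fintype.ofFinite _
  have hX : Fintype.card (Projectivization F (Fin 2 → F)) = q + 1 := by
    rw [← Nat.card_eq_fintype_card, Projectivization.card_of_finrank_two F (Fin 2 → F) (by simp),
      Nat.card_eq_fintype_card, hF]
  have hq2 : 2 ≤ q := hqp.two_le
  rw [← twistedMaps_eq] at hPi
  subst hPi
  set C := (twistedMaps φ).toFinset
  have hC : IsSharplyThreeTransitive C := isSharplyThreeTransitive_toFinset φ
  have hsub : 𝒻.toFinset ⊆ C := Set.toFinset_subset_toFinset.mpr h𝒻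
  have hint' : ∀ f ∈ 𝒻.toFinset, ∀ g ∈ 𝒻.toFinset, ∃ x, f x = g x := by simpa using hint
  have hcast : ((q * (q - 1) : ℕ) : ℤ) = q * (q - 1) := by
    rw [Nat.cast_mul, Nat.cast_sub (by omega), Nat.cast_one]
  rw [Set.ncard_eq_toFinset_card']
  refine ⟨?_, fun hcard => ?_, ?_⟩
  · have := hC.card_le_of_intersecting hq2 hX hsub hint'
    rw [← hcast] at this
    exact_mod_cast this
  · obtain ⟨P, Q, hPQ⟩ := hC.exists_eq_filter_of_card_eq hq2 hX hsub hint'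
      (by rw [hcard, hcast])
    refine ⟨P, Q, ?_⟩
    ext f
    rw [← Set.mem_toFinset, hPQ]
    simp [C]
  · rintro ⟨P, Q, hPQ⟩
    have h := hC.throughCount_eq hq2 hX P Q
    rw [throughCount, ← hcast, Nat.cast_inj] at h
    rw [← h]
    congr 1
    ext f
    rw [Set.mem_toFinset, hPQ]
    simp [C]
end
end
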